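/- arXiv:1606.06705 — 2 statements merged into one kernel-verified Lean document; each statement's English description precedes it below -/
import Mathlib

section
/- Let 0 < q, r < ∞ and let u, v, w be weights on (0,∞). The inequality (∫_0^∞ u(t) sup_{s>t} (∫_t^s w)^{r/q} (∫_s^∞ h)^r dt)^{1/r} ≤ C ∫_0^∞ h v for all nonnegative measurable h holds if and only if the inequality (∫_0^∞ u(t) (∫_t^∞ (∫_t^s w)^{1/q} h(s) ds)^r dt)^{1/r} ≤ C' ∫_0^∞ h v for all nonnegative measurable h holds, and the best constants C and C' are equivalent up to multiplicative constants independent of u, v, w. -/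
open MeasureTheory ENNReal Set

/-- A weight on `(0,∞)`: measurable, with positive finite integral over each `(0,x]`. -/
def IsWeight (v : ℝ → ℝ≥0∞) : Prop :=
  Measurable v ∧ ∀ x > (0 : ℝ),
    (0 < ∫⁻ t in Set.Ioc 0 x, v t) ∧ (∫⁻ t in Set.Ioc 0 x, v t) < ∞

/-- The kernel operator `h ↦ ∫_t^∞ (G s - G t)^p h(s) ds`. -/
noncomputable def kernelIntegral (G : ℝ → ℝ≥0∞) (p : ℝ) (h : ℝ → ℝ≥0∞) (t : ℝ) : ℝ≥0∞ :=
  ∫⁻ s in Ioi t, (G s - G t) ^ p * h s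

/-- The supremal operator `h ↦ sup_{s > t} (G s - G t)^p ∫_s^∞ h`. -/
noncomputable def kernelSup (G : ℝ → ℝ≥0∞) (p : ℝ) (h : ℝ → ℝ≥0∞) (t : ℝ) : ℝ≥0∞ :=
  ⨆ s ∈ Ioi t, (G s - G t) ^ p * ∫⁻ y in Ioi s, h y

lemma kernelSup_mono {G : ℝ → ℝ≥0∞} {p : ℝ} {h g : ℝ → ℝ≥0∞} (hg : h ≤ g) (t : ℝ) :
    kernelSup G p h t ≤ kernelSup G p g t := by
  unfold kernelSup
  gcongr
  exact hg _

lemma antitone_kernelSup {G : ℝ → ℝ≥0∞} (hG : Monotone G) {p : ℝ} (hp : 0 < p)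
    (h : ℝ → ℝ≥0∞) : Antitone (kernelSup G p h) := by
  intro t t' htt'
  refine iSup₂_le fun s hs => ?_
  have hs' : s ∈ Ioi t := lt_of_le_of_lt htt' hs
  refine le_trans ?_ (le_iSup₂ (f := fun s (_ : s ∈ Ioi t) =>
    (G s - G t) ^ p * ∫⁻ y in Ioi s, h y) s hs')
  have := hG htt'
  gcongr

lemma antitone_kernelIntegral {G : ℝ → ℝ≥0∞} (hG : Monotone G) {p : ℝ} (hp : 0 < p)
    (h : ℝ → ℝ≥0∞) : Antitone (kernelIntegral G p h) := by
  intro t t' htt'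
  unfold kernelIntegral
  refine (lintegral_mono_set (Ioi_subset_Ioi htt')).trans ?_
  have := hG htt'
  gcongr

lemma measurable_kernel {G : ℝ → ℝ≥0∞} (hG : Monotone G) (p : ℝ) (t : ℝ) :
    Measurable fun s => (G s - G t) ^ p :=
  (hG.measurable.sub_const _).pow_const _

lemma kernelIntegral_eq_lintegral {G : ℝ → ℝ≥0∞} (hG : Monotone G) {p : ℝ} (hp : 0 < p)
    (h : ℝ → ℝ≥0∞) (t : ℝ) :
    kernelIntegral G p h t = ∫⁻ s, (G s - G t) ^ p * h s := by
  unfold kernelIntegral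
  rw [← lintegral_indicator measurableSet_Ioi]
  congr 1
  ext s
  by_cases hs : t < s
  · simp [hs]
  · have : G s - G t = 0 := tsub_eq_zero_of_le (hG (not_lt.mp hs))
    simp [hs, this, ENNReal.zero_rpow_of_pos hp]

lemma continuous_kernelIntegral {G : ℝ → ℝ≥0∞} (hG : Monotone G) (hGc : Continuous G)
    (hGf : ∀ x, G x ≠ ∞) {p : ℝ} (hp : 0 < p) {h : ℝ → ℝ≥0∞} (hm : Measurable h)
    (hi : ∫⁻ s, h s ≠ ∞) {n : ℝ} (hn : ∀ s, n < s → h s = 0) :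
    Continuous (kernelIntegral G p h) := by
  rw [funext (kernelIntegral_eq_lintegral hG hp h)]
  refine continuous_iff_continuousAt.mpr fun t => ?_
  refine tendsto_lintegral_filter_of_dominated_convergence (fun s => (G n) ^ p * h s) ?_ ?_ ?_ ?_
  · exact .of_forall fun t => (measurable_kernel hG p t).mul hm
  · refine .of_forall fun t => .of_forall fun s => ?_
    rcases lt_or_ge n s with hs | hs
    · simp [hn s hs]
    · have : G s - G t ≤ G n := tsub_le_self.trans (hG hs)
      gcongr
  · rw [lintegral_const_mul _ hm]
    exact ENNReal.mul_ne_top (ENNReal.rpow_ne_top_of_nonneg hp.le (hGf n)) hi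
  · have hf : ∀ᵐ s, h s ≠ ∞ := by
      filter_upwards [ae_lt_top hm hi] with s hs using hs.ne
    filter_upwards [hf] with s hs
    refine ENNReal.Tendsto.mul_const ?_ (Or.inr hs)
    exact (ENNReal.continuous_rpow_const.comp
      ((ENNReal.continuous_sub_left (hGf s)).comp hGc)).continuousAt

lemma exists_ne_zero_and_mul_le_of_tsum {ι : Type*} (α β : ι → ℝ≥0∞)
    (h0 : ∑' i, α i ≠ 0) (hα : ∑' i, α i ≠ ∞) (hβ : ∑' i, β i ≠ ∞) :
    ∃ i, α i ≠ 0 ∧ β i * (∑' j, α j) ≤ 2 * (∑' j, β j) * α i := by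
  by_contra! hcon
  obtain ⟨i₀, hi₀⟩ : ∃ i, α i ≠ 0 := by
    by_contra! h
    exact h0 (by simp [h])
  have hle : ∀ i, 2 * (∑' j, β j) * α i ≤ β i * ∑' j, α j := by
    intro i
    by_cases hi : α i = 0
    · simp [hi]
    · exact (hcon i hi).le
  have hsum : 2 * (∑' j, β j) * (∑' j, α j) ≤ (∑' j, β j) * ∑' j, α j := by
    rw [← ENNReal.tsum_mul_left, ← ENNReal.tsum_mul_right]
    exact ENNReal.tsum_le_tsum hle
  have hsum' : 2 * (∑' j, β j) ≤ 1 * (∑' j, β j) := by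
    rw [one_mul]
    exact (ENNReal.mul_le_mul_iff_left h0 hα).mp hsum
  have hb : ∑' j, β j = 0 := by
    by_contra hb
    have := (ENNReal.mul_le_mul_iff_left hb hβ).mp hsum'
    norm_num at this
  have := hcon i₀ hi₀
  rw [hb, ENNReal.tsum_eq_zero.mp hb i₀] at this
  simp at this

lemma exists_concentrated {G : ℝ → ℝ≥0∞} (hG : Monotone G) (hGc : Continuous G)
    (hGf : ∀ x, G x ≠ ∞) {p : ℝ} (hp : 0 < p) {h v : ℝ → ℝ≥0∞} (hm : Measurable h)
    (hv : Measurable v) (t t' : ℝ)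
    (ha : ∫⁻ s in Ioc t t', (G s - G t) ^ p * h s ≠ ∞) (hb : ∫⁻ s in Ioc t t', h s * v s ≠ ∞) :
    ∃ g : ℝ → ℝ≥0∞, Measurable g ∧ ∫⁻ s, g s * v s ≤ 2 * ∫⁻ s in Ioc t t', h s * v s ∧
      ∫⁻ s in Ioc t t', (G s - G t) ^ p * h s ≤ 2 * kernelSup G p g t := by
  by_cases h0 : ∫⁻ s in Ioc t t', (G s - G t) ^ p * h s = 0
  · exact ⟨0, measurable_zero, by simp, by simp [h0]⟩
  set K : ℝ → ℝ≥0∞ := fun s => (G s - G t) ^ p with hK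
  have hKm : Measurable K := measurable_kernel hG p t
  have hKf : ∀ s, K s ≠ ∞ := fun s =>
    ENNReal.rpow_ne_top_of_nonneg hp.le (ENNReal.sub_ne_top (hGf s))
  have hKc : Continuous K :=
    ENNReal.continuous_rpow_const.comp ((ENNReal.continuous_sub_right (G t)).comp hGc)
  have hKt : ∀ s ≤ t, K s = 0 := fun s hs => by
    simp [hK, tsub_eq_zero_of_le (hG hs), ENNReal.zero_rpow_of_pos hp]
  set B : ℤ → Set ℝ := fun j => Ioc t t' ∩ K ⁻¹' Ico (2 ^ j) (2 ^ (j + 1)) with hB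
  have hBm : ∀ j, MeasurableSet (B j) := fun j =>
    measurableSet_Ioc.inter (hKm measurableSet_Ico)
  have hBd : Pairwise (Function.onFun Disjoint B) := by
    have h1 : Monotone fun n : ℤ => (2 : ℝ≥0∞) ^ n := fun a b hab =>
      ENNReal.zpow_le_of_le (by norm_num) hab
    intro i j hij
    exact ((h1.pairwise_disjoint_on_Ico_succ hij).preimage K).mono inter_subset_right
      inter_subset_right
  have hBu : ⋃ j, B j ⊆ Ioc t t' := iUnion_subset fun j => inter_subset_left
  have hsa : ∑' j, ∫⁻ s in B j, K s * h s = ∫⁻ s in Ioc t t', K s * h s := by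
    rw [← lintegral_iUnion hBm hBd]
    refine le_antisymm (lintegral_mono_set hBu) ?_
    rw [← lintegral_indicator measurableSet_Ioc,
      ← lintegral_indicator (MeasurableSet.iUnion hBm)]
    refine lintegral_mono fun s => ?_
    by_cases hs : s ∈ Ioc t t'
    · by_cases hk : K s = 0
      · simp [indicator, hk]
      · obtain ⟨j, hj⟩ := ENNReal.exists_mem_Ico_zpow hk (hKf s) (y := 2) (by norm_num)
          (by norm_num)
        have : s ∈ ⋃ j, B j := mem_iUnion.mpr ⟨j, hs, hj⟩
        simp [indicator_of_mem hs, indicator_of_mem this]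
    · simp [indicator_of_notMem hs]
  have hsb : ∑' j, ∫⁻ s in B j, h s * v s ≤ ∫⁻ s in Ioc t t', h s * v s := by
    rw [← lintegral_iUnion hBm hBd]
    exact lintegral_mono_set hBu
  obtain ⟨j, hj0, hj⟩ := exists_ne_zero_and_mul_le_of_tsum (fun j => ∫⁻ s in B j, K s * h s)
    (fun j => ∫⁻ s in B j, h s * v s) (by rwa [hsa]) (by rwa [hsa])
    (ne_top_of_le_ne_top hb hsb)
  rw [hsa] at hj
  set a := ∫⁻ s in Ioc t t', K s * h s
  set aj := ∫⁻ s in B j, K s * h s with haj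
  have hajf : aj ≠ ∞ := ne_top_of_le_ne_top ha (lintegral_mono_set inter_subset_left)
  have hx0 : (2 : ℝ≥0∞) ^ j ≠ 0 := (ENNReal.zpow_pos (by norm_num) (by norm_num) j).ne'
  set x := (2 : ℝ≥0∞) ^ j
  have hx2 : (2 : ℝ≥0∞) ^ (j + 1) = 2 * x := by
    rw [ENNReal.zpow_add (by norm_num) (by norm_num), zpow_one, mul_comm]
  refine ⟨(B j).indicator fun s => a / aj * h s, (hm.const_mul _).indicator (hBm j), ?_, ?_⟩
  · have : ∀ s, (B j).indicator (fun s => a / aj * h s) s * v s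
        = (B j).indicator (fun s => a / aj * (h s * v s)) s := by
      intro s
      by_cases hs : s ∈ B j <;> simp [hs, mul_assoc]
    simp_rw [this]
    rw [lintegral_indicator (hBm j), lintegral_const_mul (f := fun s => h s * v s) _ (hm.mul hv)]
    rw [mul_comm, ← mul_div_assoc]
    refine ENNReal.div_le_of_le_mul (hj.trans ?_)
    gcongr
  · set D : Set ℝ := {s | x ≤ K s}
    have hDc : IsClosed D := isClosed_le continuous_const hKc
    have hDt : ∀ s ∈ D, t < s := by
      intro s hs
      by_contra! hst
      have : x ≤ K s := hs
      rw [hKt s hst] at this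
      exact hx0 (le_zero_iff.mp this)
    have hBD : B j ⊆ D := fun s hs => hs.2.1
    have hDne : D.Nonempty := by
      by_contra hne
      have : B j = ∅ := subset_empty_iff.mp (not_nonempty_iff_eq_empty.mp hne ▸ hBD)
      exact hj0 (by simp [haj, this])
    have hDb : BddBelow D := ⟨t, fun s hs => (hDt s hs).le⟩
    have hs0 : sInf D ∈ D := hDc.csInf_mem hDne hDb
    set s₀ := sInf D
    have hle : aj ≤ 2 * x * ∫⁻ s in B j, h s := by
      rw [← lintegral_const_mul _ hm]
      refine setLIntegral_mono (hm.const_mul _) fun s hs => ?_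
      have := hs.2.2.le
      rw [hx2] at this
      gcongr
    have hBs : B j ⊆ Ici s₀ := fun s hs => csInf_le hDb (hBD hs)
    have hint : ∫⁻ y in Ioi s₀, (B j).indicator (fun s => a / aj * h s) y
        = a / aj * ∫⁻ s in B j, h s := by
      rw [setLIntegral_congr Ioi_ae_eq_Ici, setLIntegral_indicator (hBm j),
        inter_eq_left.mpr hBs, lintegral_const_mul _ hm]
    have hS : x * (a / aj * ∫⁻ s in B j, h s) ≤
        kernelSup G p ((B j).indicator fun s => a / aj * h s) t := by
      rw [← hint]
      refine le_trans ?_ (le_iSup₂ (f := fun s (_ : s ∈ Ioi t) =>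
        (G s - G t) ^ p * ∫⁻ y in Ioi s, (B j).indicator (fun s => a / aj * h s) y)
        s₀ (hDt s₀ hs0))
      gcongr
      exact hs0
    calc a = a / aj * aj := (ENNReal.div_mul_cancel hj0 hajf).symm
      _ ≤ a / aj * (2 * x * ∫⁻ s in B j, h s) := by gcongr
      _ = 2 * (x * (a / aj * ∫⁻ s in B j, h s)) := by ring
      _ ≤ _ := by gcongr

lemma add_rpow_le_two_rpow_mul {p : ℝ} (hp : 0 < p) (x y : ℝ≥0∞) :
    (x + y) ^ p ≤ 2 ^ p * (x ^ p + y ^ p) := by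
  have h1 : x + y ≤ 2 * max x y := by
    rw [two_mul]
    exact add_le_add (le_max_left _ _) (le_max_right _ _)
  calc (x + y) ^ p ≤ (2 * max x y) ^ p := by gcongr
    _ = 2 ^ p * max x y ^ p := ENNReal.mul_rpow_of_nonneg _ _ hp.le
    _ ≤ _ := by
      gcongr
      rcases max_choice x y with h | h <;> rw [h]
      · exact le_self_add
      · exact le_add_self

lemma kernelIntegral_le_add {G : ℝ → ℝ≥0∞} (hG : Monotone G) {p : ℝ} (hp : 0 < p)
    {h : ℝ → ℝ≥0∞} (hm : Measurable h) {t t' : ℝ} (htt' : t < t') :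
    kernelIntegral G p h t ≤ (∫⁻ s in Ioc t t', (G s - G t) ^ p * h s)
      + 2 ^ p * (kernelSup G p h t + kernelIntegral G p h t') := by
  have hsplit : kernelIntegral G p h t = (∫⁻ s in Ioc t t', (G s - G t) ^ p * h s)
      + ∫⁻ s in Ioi t', (G s - G t) ^ p * h s := by
    unfold kernelIntegral
    rw [← Ioc_union_Ioi_eq_Ioi htt'.le, lintegral_union measurableSet_Ioi]
    exact Ioc_disjoint_Ioi le_rfl
  rw [hsplit]
  gcongr
  have hS : (G t' - G t) ^ p * ∫⁻ y in Ioi t', h y ≤ kernelSup G p h t :=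
    le_iSup₂ (f := fun s (_ : s ∈ Ioi t) => (G s - G t) ^ p * ∫⁻ y in Ioi s, h y) t' htt'
  calc ∫⁻ s in Ioi t', (G s - G t) ^ p * h s
      ≤ ∫⁻ s in Ioi t', 2 ^ p * ((G t' - G t) ^ p * h s + (G s - G t') ^ p * h s) := by
        refine lintegral_mono fun s => ?_
        rw [← add_mul, ← mul_assoc]
        gcongr
        refine le_trans ?_ (add_rpow_le_two_rpow_mul hp _ _)
        gcongr
        rw [add_comm]
        exact tsub_le_tsub_add_tsub
    _ = 2 ^ p * ((G t' - G t) ^ p * (∫⁻ y in Ioi t', h y) + kernelIntegral G p h t') := by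
        rw [lintegral_const_mul, lintegral_add_left, lintegral_const_mul _ hm]
        · rfl
        · exact hm.const_mul _
        · exact (hm.const_mul _).add ((measurable_kernel hG p t').mul hm)
    _ ≤ _ := by gcongr

/-- If the kernel integral drops by a fixed factor between `t` and `t'`, then at `t` it is
controlled by the supremal operator applied to a concentrated competitor. -/
lemma exists_kernelIntegral_le_kernelSup {G : ℝ → ℝ≥0∞} (hG : Monotone G) (hGc : Continuous G)
    (hGf : ∀ x, G x ≠ ∞) {p : ℝ} (hp : 0 < p) {h v : ℝ → ℝ≥0∞} (hm : Measurable h)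
    (hv : Measurable v) {t t' : ℝ} (htt' : t < t') (hF : kernelIntegral G p h t ≠ ∞)
    (hdrop : 2 ^ (p + 1) * kernelIntegral G p h t' ≤ kernelIntegral G p h t)
    (hb : ∫⁻ s in Ioc t t', h s * v s ≠ ∞) :
    ∃ g : ℝ → ℝ≥0∞, Measurable g ∧ ∫⁻ s, g s * v s ≤ 2 * ∫⁻ s in Ioc t t', h s * v s ∧
      kernelIntegral G p h t ≤ 4 * kernelSup G p g t + 2 ^ (p + 1) * kernelSup G p h t := by
  obtain ⟨g, hgm, hgv, hga⟩ := exists_concentrated hG hGc hGf hp hm hv t t'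
    (ne_top_of_le_ne_top hF (lintegral_mono_set Ioc_subset_Ioi_self)) hb
  refine ⟨g, hgm, hgv, ?_⟩
  have h1 := kernelIntegral_le_add hG hp hm htt'
  have h2 : (2 : ℝ≥0∞) ^ (p + 1) = 2 * 2 ^ p := by
    rw [ENNReal.rpow_add _ _ (by norm_num) (by norm_num), ENNReal.rpow_one, mul_comm]
  rw [h2] at hdrop ⊢
  set F := kernelIntegral G p h t
  set F' := kernelIntegral G p h t'
  set a := ∫⁻ s in Ioc t t', (G s - G t) ^ p * h s
  set S := kernelSup G p h t
  have h3 : F + F ≤ (4 * kernelSup G p g t + 2 * 2 ^ p * S) + F := by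
    calc F + F ≤ (a + 2 ^ p * (S + F')) + (a + 2 ^ p * (S + F')) := add_le_add h1 h1
      _ = 2 * a + 2 * 2 ^ p * S + 2 * 2 ^ p * F' := by ring
      _ ≤ 2 * (2 * kernelSup G p g t) + 2 * 2 ^ p * S + F := by gcongr
      _ = _ := by ring
  exact (ENNReal.add_le_add_iff_right hF).mp h3

/-- A bounded-support function has a competitor of comparable weighted norm whose supremal
operator dominates the kernel integral pointwise. -/
lemma exists_forall_kernelIntegral_le_kernelSup {G : ℝ → ℝ≥0∞} (hG : Monotone G)
    (hGc : Continuous G) (hGf : ∀ x, G x ≠ ∞) {p : ℝ} (hp : 0 < p) {h v : ℝ → ℝ≥0∞}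
    (hm : Measurable h) (hv : Measurable v) (hi : ∫⁻ s, h s ≠ ∞) {n : ℝ} (hn0 : 0 ≤ n)
    (hn : ∀ s, n < s → h s = 0) (hb : ∫⁻ s in Ioi 0, h s * v s ≠ ∞) :
    ∃ g : ℝ → ℝ≥0∞, Measurable g ∧
      ∫⁻ s in Ioi 0, g s * v s ≤ 3 * ∫⁻ s in Ioi 0, h s * v s ∧
      ∀ t > 0, kernelIntegral G p h t ≤
        2 ^ (p + 1) * (4 + 2 ^ (p + 1)) * kernelSup G p g t := by
  set F := kernelIntegral G p h with hFdef
  have hFa : Antitone F := antitone_kernelIntegral hG hp h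
  have hFc : Continuous F := continuous_kernelIntegral hG hGc hGf hp hm hi hn
  have hFn : F n = 0 := by
    rw [hFdef, kernelIntegral, setLIntegral_congr_fun measurableSet_Ioi
      (g := fun _ => 0) (fun s hs => by simp [hn s hs])]
    simp
  have hFf : ∀ t, F t ≠ ∞ := by
    intro t
    refine ne_top_of_le_ne_top
      (ENNReal.mul_ne_top (ENNReal.rpow_ne_top_of_nonneg hp.le (hGf n)) hi) ?_
    · rw [hFdef, kernelIntegral_eq_lintegral hG hp, ← lintegral_const_mul _ hm]
      refine lintegral_mono fun s => ?_
      rcases lt_or_ge n s with hs | hs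
      · simp [hn s hs]
      · have : G s - G t ≤ G n := tsub_le_self.trans (hG hs)
        gcongr
  by_cases hF0 : F 0 = 0
  · refine ⟨0, measurable_zero, by simp, fun t ht => ?_⟩
    have : F t = 0 := le_zero_iff.mp (hF0 ▸ hFa (le_of_lt ht))
    simp [this]
  set M : ℝ≥0∞ := 2 ^ (p + 1) with hM
  have hM1 : 1 < M := ENNReal.one_lt_rpow (by norm_num) (by linarith)
  have hM0 : M ≠ 0 := (zero_lt_one.trans hM1).ne'
  have hMf : M ≠ ∞ := ENNReal.rpow_ne_top_of_nonneg (by linarith) (by norm_num)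
  have hMi : M⁻¹ < 1 := ENNReal.inv_lt_one.mpr hM1
  have hex : ∀ k : ℕ, ∃ t ∈ Icc 0 n, F t = F 0 * M⁻¹ ^ k := by
    intro k
    refine intermediate_value_Icc' hn0 hFc.continuousOn ⟨by simp [hFn], ?_⟩
    exact mul_le_of_le_one_right' (pow_le_one₀ zero_le hMi.le)
  choose τ hτ hFτ using hex
  have hlevel : ∀ k, M * F (τ (k + 1)) = F (τ k) := by
    intro k
    rw [hFτ, hFτ, pow_succ]
    calc M * (F 0 * (M⁻¹ ^ k * M⁻¹)) = F 0 * M⁻¹ ^ k * (M * M⁻¹) := by ring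
      _ = _ := by rw [ENNReal.mul_inv_cancel hM0 hMf, mul_one]
  have hpos : ∀ k, F (τ k) ≠ 0 := by
    intro k
    rw [hFτ]
    exact mul_ne_zero hF0 (pow_ne_zero _ (ENNReal.inv_ne_zero.mpr hMf))
  have hlt : ∀ k, τ k < τ (k + 1) := by
    intro k
    by_contra! hle
    have h1 := hFa hle
    rw [← hlevel k] at h1
    have h2 : M * F (τ (k + 1)) ≤ 1 * F (τ (k + 1)) := by rwa [one_mul]
    exact absurd ((ENNReal.mul_le_mul_iff_left (hpos _) (hFf _)).mp h2) (not_le.mpr hM1)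
  have hmono : Monotone τ := monotone_nat_of_le_succ fun k => (hlt k).le
  have hsub : ∀ k, Ioc (τ k) (τ (k + 1)) ⊆ Ioi 0 := fun k s hs =>
    lt_of_le_of_lt (hτ k).1 hs.1
  have hstep := fun k => exists_kernelIntegral_le_kernelSup hG hGc hGf hp hm hv (hlt k)
    (hFf (τ k)) (hlevel k).le (ne_top_of_le_ne_top hb (lintegral_mono_set (hsub k)))
  choose g hgm hgv hgF using hstep
  refine ⟨fun s => h s + ∑' k, g k s, hm.add (Measurable.tsum hgm), ?_, ?_⟩
  · have hdisj : Pairwise (Function.onFun Disjoint fun k => Ioc (τ k) (τ (k + 1))) :=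
      hmono.pairwise_disjoint_on_Ioc_succ
    have hsum : ∑' k, ∫⁻ s in Ioc (τ k) (τ (k + 1)), h s * v s ≤ ∫⁻ s in Ioi 0, h s * v s := by
      rw [← lintegral_iUnion (fun k => measurableSet_Ioc) hdisj]
      exact lintegral_mono_set (iUnion_subset hsub)
    calc ∫⁻ s in Ioi 0, (h s + ∑' k, g k s) * v s
        = (∫⁻ s in Ioi 0, h s * v s) + ∑' k, ∫⁻ s in Ioi 0, g k s * v s := by
          rw [← lintegral_tsum (f := fun k s => g k s * v s)
              fun k => ((hgm k).mul hv).aemeasurable,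
            ← lintegral_add_left (f := fun s => h s * v s) (hm.mul hv)]
          simp_rw [add_mul, ENNReal.tsum_mul_right]
      _ ≤ (∫⁻ s in Ioi 0, h s * v s)
          + ∑' k, 2 * ∫⁻ s in Ioc (τ k) (τ (k + 1)), h s * v s := by
          gcongr with k
          exact (setLIntegral_le_lintegral _ _).trans (hgv k)
      _ ≤ (∫⁻ s in Ioi 0, h s * v s) + 2 * ∫⁻ s in Ioi 0, h s * v s := by
          rw [ENNReal.tsum_mul_left]
          gcongr
      _ = _ := by ring
  · intro t ht
    by_cases hFt : F t = 0
    · simp [hFt]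
    have hex : ∃ k : ℕ, F 0 * M⁻¹ ^ k < F t := by
      have h1 : Filter.Tendsto (fun k : ℕ => F 0 * M⁻¹ ^ k) Filter.atTop (nhds (F 0 * 0)) :=
        ENNReal.Tendsto.const_mul (ENNReal.tendsto_pow_atTop_nhds_zero_of_lt_one hMi)
          (Or.inr (hFf 0))
      rw [mul_zero] at h1
      exact (h1.eventually (gt_mem_nhds (pos_iff_ne_zero.mpr hFt))).exists
    classical
    have hk := Nat.find_spec hex
    have hkm := fun m => Nat.find_min hex (m := m)
    set k := Nat.find hex
    have hk0 : k ≠ 0 := by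
      intro h0
      rw [h0] at hk
      simp only [pow_zero, mul_one] at hk
      exact absurd (hFa (le_of_lt ht)) (not_le.mpr hk)
    obtain ⟨m, hmk⟩ := Nat.exists_eq_succ_of_ne_zero hk0
    have hFm : F t ≤ F (τ m) := by
      rw [hFτ]
      exact not_lt.mp (hkm m (by omega))
    rw [← hFτ, hmk] at hk
    have htm : t ≤ τ (m + 1) := by
      by_contra! hcon
      exact absurd (hFa hcon.le) (not_le.mpr hk)
    set g' : ℝ → ℝ≥0∞ := fun s => h s + ∑' k, g k s
    have e1 : kernelSup G p (g (m + 1)) (τ (m + 1)) ≤ kernelSup G p g' t :=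
      (kernelSup_mono (fun s => (ENNReal.le_tsum (m + 1)).trans le_add_self) _).trans
        (antitone_kernelSup hG hp _ htm)
    have e2 : kernelSup G p h (τ (m + 1)) ≤ kernelSup G p g' t :=
      (kernelSup_mono (fun s => le_self_add) _).trans (antitone_kernelSup hG hp _ htm)
    calc F t ≤ M * F (τ (m + 1)) := by rw [hlevel]; exact hFm
      _ ≤ M * (4 * kernelSup G p g' t + M * kernelSup G p g' t) := by
        gcongr
        exact (hgF (m + 1)).trans (by gcongr)
      _ = _ := by ring

lemma continuous_setLIntegral_Ioc {w : ℝ → ℝ≥0∞} (hw : Measurable w)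
    (hf : ∀ x > (0 : ℝ), ∫⁻ t in Ioc 0 x, w t < ∞) :
    Continuous fun x => ∫⁻ t in Ioc 0 x, w t := by
  refine continuous_iff_continuousAt.mpr fun x => ?_
  simp_rw [← lintegral_indicator measurableSet_Ioc]
  refine tendsto_lintegral_filter_of_dominated_convergence
    ((Ioc 0 (|x| + 1)).indicator w) ?_ ?_ ?_ ?_
  · exact .of_forall fun y => hw.indicator measurableSet_Ioc
  · have : ∀ᶠ y in nhds x, y < |x| + 1 :=
      gt_mem_nhds (lt_of_le_of_lt (le_abs_self x) (lt_add_one _))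
    filter_upwards [this] with y hy
    exact .of_forall fun s => indicator_le_indicator_of_subset
      (Ioc_subset_Ioc_right hy.le) (fun _ => zero_le) s
  · rw [lintegral_indicator measurableSet_Ioc]
    exact (hf _ (by positivity)).ne
  · filter_upwards [Measure.ae_ne volume x] with s hs
    refine tendsto_const_nhds.congr' ?_
    rcases lt_or_gt_of_ne hs with h | h
    · filter_upwards [lt_mem_nhds h] with y hy
      simp [indicator, h.le, hy.le]
    · filter_upwards [gt_mem_nhds h] with y hy
      simp [indicator, not_le.mpr h, not_le.mpr hy]

lemma setLIntegral_Ioc_eq_sub {w : ℝ → ℝ≥0∞}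
    (hf : ∀ x, ∫⁻ t in Ioc 0 x, w t ≠ ∞) {t s : ℝ} (ht : 0 ≤ t) (hs : t ≤ s) :
    ∫⁻ y in Ioc t s, w y = (∫⁻ y in Ioc 0 s, w y) - ∫⁻ y in Ioc 0 t, w y := by
  rw [← Ioc_union_Ioc_eq_Ioc ht hs, lintegral_union measurableSet_Ioc
    (Ioc_disjoint_Ioc_of_le le_rfl), ENNReal.add_sub_cancel_left (hf t)]

lemma iSup_truncation (h : ℝ → ℝ≥0∞) {s : ℝ} (hs : 0 < s) :
    ⨆ n : ℕ, (Ioc (0 : ℝ) n).indicator (fun x => min (h x) n) s = h s := by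
  refine le_antisymm (iSup_le fun n => ?_) ?_
  · exact indicator_le_self' (fun _ _ => zero_le) s |>.trans (min_le_left _ _)
  · refine le_of_forall_lt fun c hc => ?_
    obtain ⟨n, hn⟩ := ENNReal.exists_nat_gt hc.ne_top
    obtain ⟨m, hm⟩ := exists_nat_ge s
    refine lt_of_lt_of_le ?_ (le_iSup _ (max n m))
    have : s ∈ Ioc (0 : ℝ) (max n m : ℕ) :=
      ⟨hs, hm.trans (by exact_mod_cast le_max_right n m)⟩
    rw [indicator_of_mem this]
    exact lt_min hc (hn.trans_le (by exact_mod_cast le_max_left n m))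

lemma monotone_truncation (h : ℝ → ℝ≥0∞) :
    Monotone fun (n : ℕ) => (Ioc (0 : ℝ) n).indicator (fun x => min (h x) n) := by
  intro n m hnm s
  have h1 : (n : ℝ) ≤ m := by exact_mod_cast hnm
  have h2 : (n : ℝ≥0∞) ≤ m := by exact_mod_cast hnm
  refine (indicator_le_indicator_of_subset (Ioc_subset_Ioc_right h1)
    (fun _ => zero_le) s).trans (indicator_le_indicator ?_)
  exact min_le_min_left _ h2

/-- equivalence of supremal and integral forms: the inequality
`(∫ u(t) sup_{s>t} (∫_t^s w)^{r/q} (∫_s^∞ h)^r dt)^{1/r} ≤ C ∫ h v`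
holds for all `h` iff
`(∫ u(t) (∫_t^∞ (∫_t^s w)^{1/q} h(s) ds)^r dt)^{1/r} ≤ C' ∫ h v`
holds for all `h`, with best constants equivalent up to constants
independent of `u, v, w`. -/
theorem sup_form_iff_integral_form
    (q r : ℝ) (hq : 0 < q) (hr : 0 < r) :
    ∃ c : ℝ≥0∞, 0 < c ∧ c < ∞ ∧
      ∀ u v w : ℝ → ℝ≥0∞, IsWeight u → IsWeight v → IsWeight w →
      ∀ C : ℝ≥0∞,
        ((∀ h : ℝ → ℝ≥0∞, Measurable h →
            (∫⁻ t in Set.Ioi (0 : ℝ),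
                u t * (∫⁻ s in Set.Ioi t,
                  (∫⁻ y in Set.Ioc t s, w y) ^ (1 / q) * h s) ^ r) ^ (1 / r)
              ≤ C * ∫⁻ s in Set.Ioi (0 : ℝ), h s * v s) →
          (∀ h : ℝ → ℝ≥0∞, Measurable h →
            (∫⁻ t in Set.Ioi (0 : ℝ),
                u t * ⨆ s ∈ Set.Ioi t,
                  (∫⁻ y in Set.Ioc t s, w y) ^ (r / q) * (∫⁻ y in Set.Ioi s, h y) ^ r) ^ (1 / r)
              ≤ C * ∫⁻ s in Set.Ioi (0 : ℝ), h s * v s)) ∧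
        ((∀ h : ℝ → ℝ≥0∞, Measurable h →
            (∫⁻ t in Set.Ioi (0 : ℝ),
                u t * ⨆ s ∈ Set.Ioi t,
                  (∫⁻ y in Set.Ioc t s, w y) ^ (r / q) * (∫⁻ y in Set.Ioi s, h y) ^ r) ^ (1 / r)
              ≤ C * ∫⁻ s in Set.Ioi (0 : ℝ), h s * v s) →
          (∀ h : ℝ → ℝ≥0∞, Measurable h →
            (∫⁻ t in Set.Ioi (0 : ℝ),
                u t * (∫⁻ s in Set.Ioi t,
                  (∫⁻ y in Set.Ioc t s, w y) ^ (1 / q) * h s) ^ r) ^ (1 / r)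
              ≤ c * C * ∫⁻ s in Set.Ioi (0 : ℝ), h s * v s)) := by
  refine ⟨2 ^ (1 / q + 1) * (4 + 2 ^ (1 / q + 1)) * 3, ?_, ?_, ?_⟩
  · have : (0 : ℝ≥0∞) < 2 ^ (1 / q + 1) := ENNReal.rpow_pos (by norm_num) (by norm_num)
    positivity
  · have : (2 : ℝ≥0∞) ^ (1 / q + 1) ≠ ∞ :=
      ENNReal.rpow_ne_top_of_nonneg (by positivity) (by norm_num)
    have h4 : (4 : ℝ≥0∞) + 2 ^ (1 / q + 1) ≠ ∞ := ENNReal.add_ne_top.mpr ⟨by norm_num, this⟩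
    exact (ENNReal.mul_ne_top (ENNReal.mul_ne_top this h4) (by norm_num)).lt_top
  intro u v w hu hv hw C
  have hp : 0 < 1 / q := by positivity
  have hrq : ∀ x y : ℝ≥0∞, x ^ (r / q) * y ^ r = (x ^ (1 / q) * y) ^ r := by
    intro x y
    rw [ENNReal.mul_rpow_of_nonneg _ _ hr.le, ← ENNReal.rpow_mul]
    congr 2
    ring
  constructor
  · intro H h hm
    refine le_trans ?_ (H h hm)
    gcongr with t
    refine iSup₂_le fun s hs => ?_
    rw [hrq]
    gcongr
    rw [← lintegral_const_mul _ hm]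
    refine (setLIntegral_mono' measurableSet_Ioi (g := fun y =>
      (∫⁻ y in Ioc t y, w y) ^ (1 / q) * h y) fun y hy => ?_).trans
      (lintegral_mono_set (Ioi_subset_Ioi (le_of_lt hs)))
    have hsy : s ≤ y := le_of_lt hy
    gcongr
  · intro H h hm
    set c₁ : ℝ≥0∞ := 2 ^ (1 / q + 1) * (4 + 2 ^ (1 / q + 1)) with hc₁
    have hc₁f : c₁ ≠ ∞ := by
      have : (2 : ℝ≥0∞) ^ (1 / q + 1) ≠ ∞ :=
        ENNReal.rpow_ne_top_of_nonneg (by positivity) (by norm_num)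
      exact ENNReal.mul_ne_top this (ENNReal.add_ne_top.mpr ⟨by norm_num, this⟩)
    set G : ℝ → ℝ≥0∞ := fun x => ∫⁻ t in Ioc 0 x, w t with hGdef
    have hG : Monotone G := fun a b hab => lintegral_mono_set (Ioc_subset_Ioc_right hab)
    have hGc : Continuous G := continuous_setLIntegral_Ioc hw.1 fun x hx => (hw.2 x hx).2
    have hGf : ∀ x, G x ≠ ∞ := by
      intro x
      rcases lt_or_ge 0 x with hx | hx
      · exact (hw.2 x hx).2.ne
      · simp [hGdef, Ioc_eq_empty_of_le hx]
    have hF : ∀ h : ℝ → ℝ≥0∞, ∀ t > 0,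
        ∫⁻ s in Ioi t, (∫⁻ y in Ioc t s, w y) ^ (1 / q) * h s = kernelIntegral G (1 / q) h t := by
      intro h t ht
      refine setLIntegral_congr_fun measurableSet_Ioi fun s hs => ?_
      simp only [hGdef]
      rw [setLIntegral_Ioc_eq_sub hGf (le_of_lt ht) (le_of_lt hs)]
    have hS : ∀ g : ℝ → ℝ≥0∞, ∀ t > 0,
        (⨆ s ∈ Ioi t, (∫⁻ y in Ioc t s, w y) ^ (r / q) * (∫⁻ y in Ioi s, g y) ^ r)
          = kernelSup G (1 / q) g t ^ r := by
      intro g t ht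
      have hmap := (ENNReal.orderIsoRpow r hr).map_iSup₂
        (fun s (_ : s ∈ Ioi t) => (G s - G t) ^ (1 / q) * ∫⁻ y in Ioi s, g y)
      simp only [ENNReal.orderIsoRpow_apply] at hmap
      rw [kernelSup, hmap]
      refine iSup_congr fun s => iSup_congr fun hs => ?_
      rw [hrq, setLIntegral_Ioc_eq_sub hGf (le_of_lt ht) (le_of_lt hs)]
    set hT : ℕ → ℝ → ℝ≥0∞ := fun n => (Ioc (0 : ℝ) n).indicator (fun x => min (h x) n) with hTdef
    have hTm : ∀ n, Measurable (hT n) := fun n =>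
      (hm.min measurable_const).indicator measurableSet_Ioc
    have hTmono : Monotone hT := monotone_truncation h
    have hTle : ∀ n s, hT n s ≤ (Ioc (0 : ℝ) n).indicator (fun _ => (n : ℝ≥0∞)) s := fun n s =>
      indicator_le_indicator (min_le_right _ _)
    have hTh : ∀ n s, hT n s ≤ h s := fun n s =>
      (indicator_le_self' (fun _ _ => zero_le) s).trans (min_le_left _ _)
    have hbound : ∀ n, ∫⁻ t in Ioi 0, u t * kernelIntegral G (1 / q) (hT n) t ^ r
        ≤ (c₁ * 3 * C * ∫⁻ s in Ioi (0 : ℝ), h s * v s) ^ r := by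
      intro n
      have hi : ∫⁻ s, hT n s ≠ ∞ := by
        refine ne_top_of_le_ne_top ?_ (lintegral_mono (hTle n))
        rw [lintegral_indicator measurableSet_Ioc]
        simp [ENNReal.mul_eq_top]
      have hb : ∫⁻ s in Ioi 0, hT n s * v s ≠ ∞ := by
        have hvn : ∫⁻ s in Ioc (0 : ℝ) n, v s ≠ ∞ := by
          rcases lt_or_ge 0 (n : ℝ) with hx | hx
          · exact (hv.2 n hx).2.ne
          · simp [Ioc_eq_empty_of_le hx]
        refine ne_top_of_le_ne_top (ENNReal.mul_ne_top (ENNReal.natCast_ne_top n) hvn) ?_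
        rw [← lintegral_const_mul _ hv.1, ← lintegral_indicator measurableSet_Ioc]
        refine (setLIntegral_le_lintegral _ _).trans (lintegral_mono fun s => ?_)
        have := hTle n s
        by_cases hs : s ∈ Ioc (0 : ℝ) n
        · rw [indicator_of_mem hs] at this ⊢
          gcongr
        · rw [indicator_of_notMem hs] at this ⊢
          simp [le_zero_iff.mp this]
      obtain ⟨g, hgm, hgv, hgF⟩ := exists_forall_kernelIntegral_le_kernelSup hG hGc hGf hp (hTm n)
        hv.1 hi (Nat.cast_nonneg n) (fun s hs => by simp [hTdef, hs]) hb
      have hHg := H g hgm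
      rw [one_div, ENNReal.rpow_inv_le_iff hr] at hHg
      calc ∫⁻ t in Ioi 0, u t * kernelIntegral G (1 / q) (hT n) t ^ r
          ≤ ∫⁻ t in Ioi 0, c₁ ^ r * (u t * ⨆ s ∈ Ioi t,
              (∫⁻ y in Ioc t s, w y) ^ (r / q) * (∫⁻ y in Ioi s, g y) ^ r) := by
            refine setLIntegral_mono' measurableSet_Ioi fun t ht => ?_
            rw [hS g t ht, mul_left_comm, ← ENNReal.mul_rpow_of_nonneg _ _ hr.le]
            gcongr
            exact hgF t ht
        _ = c₁ ^ r * ∫⁻ t in Ioi 0, (u t * ⨆ s ∈ Ioi t,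
              (∫⁻ y in Ioc t s, w y) ^ (r / q) * (∫⁻ y in Ioi s, g y) ^ r) :=
            lintegral_const_mul' _ _ (ENNReal.rpow_ne_top_of_nonneg hr.le hc₁f)
        _ ≤ c₁ ^ r * (C * ∫⁻ s in Ioi (0 : ℝ), g s * v s) ^ r := by gcongr
        _ = (c₁ * (C * ∫⁻ s in Ioi (0 : ℝ), g s * v s)) ^ r :=
            (ENNReal.mul_rpow_of_nonneg _ _ hr.le).symm
        _ ≤ (c₁ * (C * (3 * ∫⁻ s in Ioi (0 : ℝ), h s * v s))) ^ r := by
            gcongr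
            refine hgv.trans ?_
            gcongr with s
            exact hTh n s
        _ = _ := by
            congr 1
            ring
    rw [one_div r, ENNReal.rpow_inv_le_iff hr]
    have hsup : ∀ t > 0, kernelIntegral G (1 / q) h t
        = ⨆ n, kernelIntegral G (1 / q) (hT n) t := by
      intro t ht
      unfold kernelIntegral
      rw [← lintegral_iSup (f := fun n s => (G s - G t) ^ (1 / q) * hT n s)
        (fun n => (measurable_kernel hG _ t).mul (hTm n))
        (fun n m hnm s => mul_le_mul_right (hTmono hnm s) _)]
      refine setLIntegral_congr_fun measurableSet_Ioi fun s hs => ?_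
      rw [← ENNReal.mul_iSup, iSup_truncation h (lt_trans ht hs)]
    have hsupr : ∀ t > 0, u t * kernelIntegral G (1 / q) h t ^ r
        = ⨆ n, u t * kernelIntegral G (1 / q) (hT n) t ^ r := by
      intro t ht
      have hmap := (ENNReal.orderIsoRpow r hr).map_iSup
        (fun n => kernelIntegral G (1 / q) (hT n) t)
      simp only [ENNReal.orderIsoRpow_apply] at hmap
      rw [hsup t ht, hmap, ENNReal.mul_iSup]
    rw [setLIntegral_congr_fun measurableSet_Ioi (g := fun t =>
      ⨆ n, u t * kernelIntegral G (1 / q) (hT n) t ^ r)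
      (fun t ht => by simp only; rw [hF h t ht, hsupr t ht])]
    rw [lintegral_iSup]
    · exact iSup_le hbound
    · exact fun n => hu.1.mul ((antitone_kernelIntegral hG hp _).measurable.pow_const r)
    · intro n m hnm t
      simp only [kernelIntegral]
      gcongr
      exact hTmono hnm _
end

section
/- Let 0 < r < 1, 0 < q < ∞, r' = r/(1−r), and u, v, w weights on (0,∞). The inequality (∫_0^∞ u(t) sup_{s>t} (∫_t^s w)^{r/q} (∫_s^∞ h)^r dt)^{1/r} ≤ C ∫_0^∞ h v for all nonnegative measurable h holds if and only if E₁ := (∫_0^∞ (∫_0^t u)^{r'} u(t) (ess sup_{s≥t} (∫_t^s w)^{r'/q} v(s)^{−r'}) dt)^{1/r'} < ∞ and E₂ := (∫_0^∞ (∫_0^t u(x)(∫_x^t w)^{r/q} dx)^{r'} u(t) (ess sup_{s≥t} (∫_t^s w)^{r/q} v(s)^{−r'}) dt)^{1/r'} < ∞; moreover the best constant satisfies C ≈ E₁ + E₂. -/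
open MeasureTheory ENNReal Set

/-- The supremal left-hand side
`(∫_0^∞ u(t) sup_{s>t} (∫_t^s w)^{r/q} (∫_s^∞ h)^r dt)^{1/r}`. -/
noncomputable def supLHS (q r : ℝ) (u w h : ℝ → ℝ≥0∞) : ℝ≥0∞ :=
  (∫⁻ t in Set.Ioi (0 : ℝ),
    u t * ⨆ s ∈ Set.Ioi t,
      (∫⁻ y in Set.Ioc t s, w y) ^ (r / q) * (∫⁻ y in Set.Ioi s, h y) ^ r) ^ (1 / r)

namespace SupremalHardy

/-- The integral of `f` over `(s,t]`. -/
noncomputable def mass (f : ℝ → ℝ≥0∞) (s t : ℝ) : ℝ≥0∞ := ∫⁻ y in Ioc s t, f y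

/-- The integral of `f` over `(s,∞)`. -/
noncomputable def tail (f : ℝ → ℝ≥0∞) (s : ℝ) : ℝ≥0∞ := ∫⁻ y in Ioi s, f y

/-- The essential supremum of `1/v` over `(s,∞)`. -/
noncomputable def tailSup (v : ℝ → ℝ≥0∞) (s : ℝ) : ℝ≥0∞ :=
  essSup (fun y => (v y)⁻¹) (volume.restrict (Ioi s))

/-- The supremal weight, written as a supremum over rational points. -/
noncomputable def supWeight (w v : ℝ → ℝ≥0∞) (a b t : ℝ) : ℝ≥0∞ :=
  ⨆ s : ℚ, mass w t s ^ a * tailSup v s ^ b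

theorem mass_mono {f : ℝ → ℝ≥0∞} {s s' t t' : ℝ} (hs : s' ≤ s) (ht : t ≤ t') :
    mass f s t ≤ mass f s' t' :=
  lintegral_mono_set (Ioc_subset_Ioc hs ht)

theorem mass_of_le {f : ℝ → ℝ≥0∞} {s t : ℝ} (h : t ≤ s) : mass f s t = 0 := by
  simp [mass, Ioc_eq_empty_of_le h]

theorem mass_le_add (f : ℝ → ℝ≥0∞) (x t s : ℝ) : mass f x s ≤ mass f x t + mass f t s :=
  (lintegral_mono_set Ioc_subset_Ioc_union_Ioc).trans (lintegral_union_le _ _ _)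

theorem mass_add (f : ℝ → ℝ≥0∞) {x t s : ℝ} (h₁ : x ≤ t) (h₂ : t ≤ s) :
    mass f x t + mass f t s = mass f x s := by
  unfold mass
  rw [← Ioc_union_Ioc_eq_Ioc h₁ h₂, lintegral_union measurableSet_Ioc]
  exact Set.disjoint_left.2 fun y hy hy' => absurd hy.2 (not_le.2 hy'.1)

theorem mass_lt_top {f : ℝ → ℝ≥0∞} (hf : IsWeight f) {x : ℝ} (hx : 0 ≤ x) (t : ℝ) :
    mass f x t < ∞ := by
  refine (mass_mono hx le_rfl).trans_lt ?_
  rcases le_or_gt t 0 with h | h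
  · simp [mass_of_le h]
  · exact (hf.2 t h).2

theorem mass_left_continuous (f : ℝ → ℝ≥0∞) (t y : ℝ) :
    mass f t y = ⨆ s : {s : ℚ // (s : ℝ) < y}, mass f t s := by
  have h : Ioo t y = ⋃ s : {s : ℚ // (s : ℝ) < y}, Ioc t (s : ℝ) := by
    ext z
    simp only [mem_Ioo, mem_iUnion, mem_Ioc, Subtype.exists, exists_prop]
    constructor
    · rintro ⟨h1, h2⟩
      obtain ⟨q, hq, hq'⟩ := exists_rat_btwn h2
      exact ⟨q, hq', h1, hq.le⟩
    · rintro ⟨q, h2, h1, h3⟩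
      exact ⟨h1, h3.trans_lt h2⟩
  unfold mass
  rw [← setLIntegral_congr (Ioo_ae_eq_Ioc (a := t) (b := y)), h,
    setLIntegral_iUnion_of_directed]
  refine Monotone.directed_le fun a b hab => Ioc_subset_Ioc le_rfl ?_
  exact_mod_cast hab

theorem tail_right_continuous (f : ℝ → ℝ≥0∞) (s : ℝ) :
    tail f s = ⨆ q : {q : ℚ // s < (q : ℝ)}, tail f q := by
  have h : Ioi s = ⋃ q : {q : ℚ // s < (q : ℝ)}, Ioi (q : ℝ) := by
    ext z
    simp only [mem_Ioi, mem_iUnion, Subtype.exists, exists_prop]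
    constructor
    · intro h2
      obtain ⟨q, hq, hq'⟩ := exists_rat_btwn h2
      exact ⟨q, hq, hq'⟩
    · rintro ⟨q, h2, h3⟩
      exact h2.trans h3
  unfold tail
  rw [h, setLIntegral_iUnion_of_directed]
  refine Antitone.directed_le fun a b hab => Ioi_subset_Ioi ?_
  exact_mod_cast hab

theorem iSup_rpow {ι : Sort*} (f : ι → ℝ≥0∞) {a : ℝ} (ha : 0 < a) :
    (⨆ i, f i) ^ a = ⨆ i, f i ^ a :=
  (ENNReal.orderIsoRpow a ha).map_iSup f

theorem measurable_mass_right (f : ℝ → ℝ≥0∞) (s : ℝ) : Measurable (mass f s) :=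
  Monotone.measurable fun _ _ h => mass_mono le_rfl h

theorem measurable_mass_left (f : ℝ → ℝ≥0∞) (t : ℝ) : Measurable fun s => mass f s t :=
  Antitone.measurable fun _ _ h => mass_mono h le_rfl

theorem tailSup_anti (v : ℝ → ℝ≥0∞) : Antitone (tailSup v) := fun _ _ h =>
  essSup_mono_measure' (Measure.restrict_mono (Ioi_subset_Ioi h) le_rfl)

theorem supWeight_anti (w v : ℝ → ℝ≥0∞) {a : ℝ} (ha : 0 ≤ a) (b : ℝ) :
    Antitone (supWeight w v a b) := fun _ _ h =>
  iSup_mono fun _ => mul_le_mul_left (ENNReal.rpow_le_rpow (mass_mono h le_rfl) ha) _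

theorem essSup_eq_supWeight (w v : ℝ → ℝ≥0∞) {a b : ℝ} (ha : 0 < a) (hb : 0 < b) (t : ℝ) :
    essSup (fun s => (∫⁻ y in Ioc t s, w y) ^ a * v s ^ (-b)) (volume.restrict (Ici t)) =
      supWeight w v a b t := by
  change essSup (fun s => mass w t s ^ a * v s ^ (-b)) _ = _
  simp_rw [ENNReal.rpow_neg, ← ENNReal.inv_rpow]
  apply le_antisymm
  · refine essSup_le_of_ae_le _ ?_
    have key : ∀ᵐ y : ℝ, ∀ s : ℚ, (s : ℝ) < y → (v y)⁻¹ ≤ tailSup v s := by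
      rw [ae_all_iff]
      intro s
      exact (ae_restrict_iff' measurableSet_Ioi).1
        (ENNReal.ae_le_essSup (μ := volume.restrict (Ioi (s : ℝ))) fun y => (v y)⁻¹)
    filter_upwards [ae_restrict_of_ae key] with y hy
    rw [mass_left_continuous, iSup_rpow _ ha, ENNReal.iSup_mul]
    refine iSup_le fun s => le_trans ?_ (le_iSup _ s.1)
    gcongr
    exact hy _ s.2
  · refine iSup_le fun s => ?_
    rcases le_or_gt (s : ℝ) t with h | h
    · simp [mass_of_le h, ENNReal.zero_rpow_of_pos ha]
    · have h1 : tailSup v s ^ b = essSup (fun y => (v y)⁻¹ ^ b) (volume.restrict (Ioi (s : ℝ))) :=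
        (ENNReal.orderIsoRpow b hb).essSup_apply _ _
      rw [h1, ← ENNReal.essSup_const_mul]
      refine (essSup_mono_ae ?_).trans
        (essSup_mono_measure' (Measure.restrict_mono (Ioi_subset_Ici h.le) le_rfl))
      filter_upwards [ae_restrict_mem measurableSet_Ioi] with y hy
      exact mul_le_mul_left (ENNReal.rpow_le_rpow (mass_mono le_rfl (le_of_lt hy)) ha.le) _

theorem tailSup_pos {v : ℝ → ℝ≥0∞} (hv : IsWeight v) (s : ℝ) : 0 < tailSup v s := by
  rw [pos_iff_ne_zero]
  intro h
  have h1 : ∀ᵐ y ∂(volume.restrict (Ioi s)), (v y)⁻¹ ≤ 0 := h ▸ ENNReal.ae_le_essSup _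
  set m := max s 0
  have h2 : ∀ᵐ y ∂(volume.restrict (Ioc m (m + 1))), (v y)⁻¹ ≤ 0 :=
    ae_mono (Measure.restrict_mono
      (Ioc_subset_Ioi_self.trans (Ioi_subset_Ioi (le_max_left s 0))) le_rfl) h1
  have h3 : ∀ᵐ y ∂(volume.restrict (Ioc m (m + 1))), v y < ∞ :=
    ae_lt_top hv.1 (mass_lt_top hv (le_max_right s 0) (m + 1)).ne
  have h4 : ∀ᵐ y ∂(volume.restrict (Ioc m (m + 1))), False := by
    filter_upwards [h2, h3] with y a b
    simp only [nonpos_iff_eq_zero, ENNReal.inv_eq_zero] at a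
    exact b.ne a
  have := ae_iff.1 h4
  simp at this

theorem iSup_mass_mul_tail_le (w h : ℝ → ℝ≥0∞) {a b : ℝ} (ha : 0 ≤ a) (hb : 0 < b) (t : ℝ) :
    (⨆ s ∈ Ioi t, (∫⁻ y in Ioc t s, w y) ^ a * (∫⁻ y in Ioi s, h y) ^ b) ≤
      ⨆ s : ℚ, mass w t s ^ a * tail h s ^ b := by
  refine iSup₂_le fun s _ => ?_
  change mass w t s ^ a * tail h s ^ b ≤ _
  rw [tail_right_continuous, iSup_rpow _ hb, ENNReal.mul_iSup]
  refine iSup_le fun q => le_trans ?_ (le_iSup _ q.1)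
  gcongr
  exact mass_mono le_rfl q.2.le

theorem lintegral_mass_sublevel_le (f : ℝ → ℝ≥0∞) (c : ℝ≥0∞) :
    ∫⁻ y in {t | 0 < t ∧ mass f 0 t ≤ c}, f y ≤ c := by
  set S := {t | 0 < t ∧ mass f 0 t ≤ c}
  set N := {x | x ∈ S ∧ ∀ t ∈ S, t ≤ x}
  have hN : N.Subsingleton := fun x hx y hy => le_antisymm (hy.2 x hx.1) (hx.2 y hy.1)
  have hsub : S ⊆ (⋃ q : {q : ℚ // mass f 0 q ≤ c}, Ioc (0 : ℝ) q) ∪ N := by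
    intro x hx
    by_cases hm : ∀ t ∈ S, t ≤ x
    · exact Or.inr ⟨hx, hm⟩
    · push Not at hm
      obtain ⟨t, ht, hxt⟩ := hm
      obtain ⟨q, hq, hq'⟩ := exists_rat_btwn hxt
      exact Or.inl (mem_iUnion.2 ⟨⟨q, (mass_mono le_rfl hq'.le).trans ht.2⟩, hx.1, hq.le⟩)
  refine (lintegral_mono_set hsub).trans ((lintegral_union_le _ _ _).trans ?_)
  rw [setLIntegral_measure_zero N f (hN.measure_zero volume), add_zero, setLIntegral_iUnion_of_directed]
  · exact iSup_le fun q => q.2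
  · refine Monotone.directed_le fun a b hab => Ioc_subset_Ioc le_rfl ?_
    exact_mod_cast hab

theorem add_rpow_le_two (x y : ℝ≥0∞) {a : ℝ} (ha : 0 ≤ a) :
    (x + y) ^ a ≤ 2 ^ a * (x ^ a + y ^ a) := by
  rcases le_total x y with h | h
  · calc (x + y) ^ a ≤ (2 * y) ^ a := ENNReal.rpow_le_rpow (by rw [two_mul]; gcongr) ha
      _ = 2 ^ a * y ^ a := ENNReal.mul_rpow_of_nonneg _ _ ha
      _ ≤ _ := by gcongr; exact le_add_self
  · calc (x + y) ^ a ≤ (2 * x) ^ a := ENNReal.rpow_le_rpow (by rw [two_mul]; gcongr) ha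
      _ = 2 ^ a * x ^ a := ENNReal.mul_rpow_of_nonneg _ _ ha
      _ ≤ _ := by gcongr; exact le_self_add

theorem sum_iSup_le {ι α : Type*} [Nonempty α] {f : ι → α → ℝ≥0∞} {B : ℝ≥0∞} (F : Finset ι)
    (h : ∀ σ : ι → α, ∑ i ∈ F, f i (σ i) ≤ B) : ∑ i ∈ F, ⨆ x, f i x ≤ B := by
  classical
  suffices H : ∀ (F : Finset ι) (c : ℝ≥0∞), (∀ σ : ι → α, c + ∑ i ∈ F, f i (σ i) ≤ B) →
      c + ∑ i ∈ F, ⨆ x, f i x ≤ B by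
    simpa using H F 0 (by simpa using h)
  intro F
  induction F using Finset.induction_on with
  | empty => intro c hc; simpa using hc fun _ => Classical.arbitrary α
  | insert a F ha ih =>
    intro c hc
    rw [Finset.sum_insert ha, ← add_assoc, ENNReal.add_iSup, ENNReal.iSup_add]
    refine iSup_le fun x => ih _ fun σ => ?_
    have := hc (Function.update σ a x)
    rw [Finset.sum_insert ha, Function.update_self] at this
    rw [add_assoc]
    convert this using 3
    refine Finset.sum_congr rfl fun i hi => ?_
    rw [Function.update_of_ne (by rintro rfl; exact ha hi)]

theorem rpow_sub_rpow_ge {r x y : ℝ} (hr0 : 0 < r) (hr1 : r < 1) (hy : 0 ≤ y) (hx : 0 < x) :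
    r * x ^ (r - 1) * (x - y) ≤ x ^ r - y ^ r := by
  have h := rpow_one_add_le_one_add_mul_self (s := (y - x) / x)
    (by rw [le_div_iff₀ hx]; linarith) hr0.le hr1.le
  have e : 1 + (y - x) / x = y / x := by field_simp; ring
  rw [e, Real.div_rpow hy hx.le, div_le_iff₀ (Real.rpow_pos_of_pos hx r)] at h
  have e2 : x ^ (r - 1) = x ^ r / x := Real.rpow_sub_one hx.ne' r
  have : (1 + r * ((y - x) / x)) * x ^ r = x ^ r - r * (x ^ r / x) * (x - y) := by
    field_simp
    ring
  rw [e2]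
  linarith

theorem exists_test_sequence {ι : Type*} [DecidableEq ι] {r : ℝ} (hr0 : 0 < r) (hr1 : r < 1)
    (s d l : ι → ℝ) (hd : ∀ i, 0 ≤ d i) (hl : ∀ i, 0 < l i) (S : Finset ι) :
    ∀ D : ℝ, 0 ≤ D → ∃ h : ι → ℝ, (∀ i, 0 ≤ h i) ∧
      (∀ i ∈ S, (l i * (D + ∑ j ∈ S with s j < s i, d j + d i)) ^ (1 / (1 - r)) ≤
        ∑ j ∈ S with s i ≤ s j, h j) ∧
      r * ∑ i ∈ S, h i / l i ≤ D * (∑ i ∈ S, h i) ^ r +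
        ∑ i ∈ S, d i * (∑ j ∈ S with s i ≤ s j, h j) ^ r := by
  have hr : 0 < 1 - r := by linarith
  induction S using Finset.induction_on_min_value s with
  | empty => exact fun D _ => ⟨0, by simp, by simp, by simp [Real.zero_rpow hr0.ne']⟩
  | insert a S ha hmin ih =>
    intro D hD
    obtain ⟨h, hh, h1, h2⟩ := ih (D + d a) (add_nonneg hD (hd a))
    set T := ∑ i ∈ S, h i
    have hT : 0 ≤ T := Finset.sum_nonneg fun i _ => hh i
    set x := (l a * (D + d a)) ^ (1 / (1 - r)) with hx
    have hDa : 0 ≤ D + d a := add_nonneg hD (hd a)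
    have hx0 : 0 ≤ x := Real.rpow_nonneg (mul_nonneg (hl a).le hDa) _
    have hxr : x ^ (1 - r) = l a * (D + d a) := by
      rw [hx, ← Real.rpow_mul (mul_nonneg (hl a).le hDa), one_div_mul_cancel hr.ne', Real.rpow_one]
    let g : ι → ℝ := fun i => if i = a then max 0 (x - T) else h i
    have hga : g a = max 0 (x - T) := if_pos rfl
    have hgS : ∀ i ∈ S, g i = h i := fun i hi => if_neg (by rintro rfl; exact ha hi)
    have hg0 : ∀ i, 0 ≤ g i := by
      intro i
      by_cases hi : i = a
      · rw [hi, hga]; exact le_max_left _ _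
      · simp only [g, if_neg hi]; exact hh i
    have hgT : ∑ i ∈ insert a S, g i = max 0 (x - T) + T := by
      rw [Finset.sum_insert ha, hga, Finset.sum_congr rfl hgS]
    have hga' : ∑ j ∈ insert a S with s a ≤ s j, g j = max 0 (x - T) + T := by
      rw [Finset.filter_true_of_mem, hgT]
      intro i hi
      rcases Finset.mem_insert.1 hi with rfl | hi
      · exact le_rfl
      · exact hmin i hi
    have hgi : ∀ i ∈ S, ∑ j ∈ S with s i ≤ s j, h j ≤ ∑ j ∈ insert a S with s i ≤ s j, g j := by
      intro i _
      rw [← Finset.sum_congr rfl fun j hj => hgS j (Finset.mem_filter.1 hj).1]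
      exact Finset.sum_le_sum_of_subset_of_nonneg
        (Finset.filter_subset_filter _ (Finset.subset_insert a S)) fun j _ _ => hg0 j
    have hcost : r * (max 0 (x - T) / l a) ≤ (D + d a) * ((max 0 (x - T) + T) ^ r - T ^ r) := by
      rcases le_or_gt x T with hxT | hxT
      · simp [max_eq_left (sub_nonpos.2 hxT)]
      · rw [max_eq_right (sub_nonneg.2 hxT.le), sub_add_cancel]
        have hxp : 0 < x := hT.trans_lt hxT
        have hb := mul_le_mul_of_nonneg_left (rpow_sub_rpow_ge hr0 hr1 hT hxp) hDa
        refine le_trans (le_of_eq ?_) hb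
        have e1 : D + d a = x ^ (1 - r) / l a := by
          rw [hxr]; field_simp [(hl a).ne']
        have e2 : x ^ (1 - r) * x ^ (r - 1) = 1 := by
          rw [← Real.rpow_add hxp]; simp
        rw [e1]
        have : x ^ (1 - r) / l a * (r * x ^ (r - 1) * (x - T)) =
          (x ^ (1 - r) * x ^ (r - 1)) * (r * (x - T) / l a) := by ring
        rw [this, e2]; ring
    refine ⟨g, hg0, ?_, ?_⟩
    · intro i hi
      rcases Finset.mem_insert.1 hi with rfl | hiS
      · rw [hga']
        have : ∑ j ∈ insert i S with s j < s i, d j = 0 := by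
          rw [Finset.filter_false_of_mem, Finset.sum_empty]
          intro j hj
          rcases Finset.mem_insert.1 hj with rfl | hj
          · exact lt_irrefl _
          · exact not_lt.2 (hmin j hj)
        rw [this, add_zero]
        have := le_max_right 0 (x - T)
        linarith
      · refine le_trans ?_ ((h1 i hiS).trans (hgi i hiS))
        have hsum : ∑ j ∈ insert a S with s j < s i, d j ≤ d a + ∑ j ∈ S with s j < s i, d j := by
          rw [Finset.filter_insert]
          split_ifs
          · rw [Finset.sum_insert (by simp [ha])]
          · linarith [hd a]
        have h0 : 0 ≤ ∑ j ∈ insert a S with s j < s i, d j := Finset.sum_nonneg fun j _ => hd j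
        refine Real.rpow_le_rpow (mul_nonneg (hl i).le (by linarith [hd i])) ?_ (by positivity)
        exact mul_le_mul_of_nonneg_left (by linarith) (hl i).le
    · rw [hgT, Finset.sum_insert ha, Finset.sum_insert ha, hga, hga',
        Finset.sum_congr rfl fun i hi => by rw [hgS i hi]]
      have h3 : ∑ i ∈ S, d i * (∑ j ∈ S with s i ≤ s j, h j) ^ r ≤
          ∑ i ∈ S, d i * (∑ j ∈ insert a S with s i ≤ s j, g j) ^ r :=
        Finset.sum_le_sum fun i hi => mul_le_mul_of_nonneg_left
          (Real.rpow_le_rpow (Finset.sum_nonneg fun j _ => hh j) (hgi i hi) hr0.le) (hd i)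
      rw [mul_add]
      nlinarith [h2, h3, hcost]

theorem le_of_le_mul_rpow {r : ℝ} (hr1 : r < 1) {x K : ℝ≥0∞} (hx : x ≠ ∞)
    (h : x ≤ K * x ^ r) : x ≤ K ^ (1 / (1 - r)) := by
  have hr : 0 < 1 - r := by linarith
  rcases eq_or_ne x 0 with rfl | h0
  · exact zero_le
  have h1 : x ^ (1 - r) ≤ K := by
    rw [ENNReal.rpow_sub _ _ h0 hx, ENNReal.rpow_one]
    exact ENNReal.div_le_of_le_mul h
  calc x = (x ^ (1 - r)) ^ (1 / (1 - r)) := by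
        rw [← ENNReal.rpow_mul, mul_one_div_cancel hr.ne', ENNReal.rpow_one]
    _ ≤ _ := ENNReal.rpow_le_rpow h1 (by positivity)

theorem exists_bump {v : ℝ → ℝ≥0∞} (hv : Measurable v) {s l : ℝ}
    (hl : ENNReal.ofReal l < tailSup v s) :
    ∃ f : ℝ → ℝ≥0∞, Measurable f ∧ (∀ t ≤ s, tail f t = 1) ∧
      ∫⁻ y in Ioi (0 : ℝ), f y * v y ≤ (ENNReal.ofReal l)⁻¹ := by
  set P := {y | s < y ∧ ENNReal.ofReal l < (v y)⁻¹}
  have hP : MeasurableSet P :=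
    measurableSet_Ioi.inter (measurableSet_lt measurable_const hv.inv)
  have hP0 : volume P ≠ 0 := by
    intro h0
    refine (essSup_le_of_ae_le (μ := volume.restrict (Ioi s)) (f := fun y => (v y)⁻¹)
      (ENNReal.ofReal l) ?_).not_gt hl
    refine (ae_restrict_iff' measurableSet_Ioi).2 ?_
    have : ∀ᵐ y, y ∉ P := measure_eq_zero_iff_ae_notMem.1 h0
    filter_upwards [this] with y hy hys
    by_contra hc
    exact hy ⟨hys, not_le.1 hc⟩
  obtain ⟨B, hBP, hBm, hB0, hBt⟩ :
      ∃ B ⊆ P, MeasurableSet B ∧ volume B ≠ 0 ∧ volume B ≠ ∞ := by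
    obtain ⟨B, h1, h2, h3, h4⟩ := Measure.exists_subset_measure_lt_top hP (pos_iff_ne_zero.2 hP0)
    exact ⟨B, h2, h1, h3.ne', h4.ne⟩
  refine ⟨B.indicator fun _ => (volume B)⁻¹, measurable_const.indicator hBm, ?_, ?_⟩
  · intro t ht
    unfold tail
    have hsub : B ⊆ Ioi t := fun y hy => ht.trans_lt (hBP hy).1
    rw [lintegral_indicator hBm, Measure.restrict_restrict hBm, inter_eq_left.2 hsub,
      lintegral_const, Measure.restrict_apply_univ, ENNReal.inv_mul_cancel hB0 hBt]
  · calc ∫⁻ y in Ioi (0 : ℝ), B.indicator (fun _ => (volume B)⁻¹) y * v y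
        ≤ ∫⁻ y in Ioi (0 : ℝ), B.indicator (fun _ => (volume B)⁻¹) y * (ENNReal.ofReal l)⁻¹ := by
          refine lintegral_mono fun y => ?_
          by_cases hy : y ∈ B
          · gcongr
            exact ENNReal.le_inv_iff_le_inv.1 (hBP hy).2.le
          · simp [hy]
      _ ≤ ∫⁻ y, B.indicator (fun _ => (volume B)⁻¹) y * (ENNReal.ofReal l)⁻¹ :=
          setLIntegral_le_lintegral _ _
      _ = (ENNReal.ofReal l)⁻¹ := by
          rw [lintegral_mul_const _ (measurable_const.indicator hBm), lintegral_indicator hBm,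
            lintegral_const, Measure.restrict_apply_univ, ENNReal.inv_mul_cancel hB0 hBt, one_mul]

theorem tailSup_eq_iSup {v : ℝ → ℝ≥0∞} (s l₀ : ℝ) (hl₀ : ENNReal.ofReal l₀ < tailSup v s) :
    tailSup v s = ⨆ x : ℝ,
      ENNReal.ofReal (if 0 < x ∧ ENNReal.ofReal x < tailSup v s then x else l₀) := by
  apply le_antisymm
  · refine le_of_forall_lt fun c hc => ?_
    obtain ⟨x, hcx, hx⟩ := ENNReal.lt_iff_exists_nnreal_btwn.1 hc
    have h0 : 0 < (x : ℝ) := by exact_mod_cast pos_of_gt hcx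
    refine hcx.trans_le (le_trans ?_ (le_iSup _ (x : ℝ)))
    rw [if_pos ⟨h0, by simpa using hx⟩, ENNReal.ofReal_coe_nnreal]
  · refine iSup_le fun x => ?_
    split_ifs with h
    · exact h.2.le
    · exact hl₀.le

section lower

variable {r a : ℝ} {u v w : ℝ → ℝ≥0∞} {C : ℝ≥0∞} {ι : Type*} [DecidableEq ι]

theorem lower_hardy_real (hr0 : 0 < r) (hr1 : r < 1) (ha : 0 < a) (hv : IsWeight v)
    (hC : ∀ h : ℝ → ℝ≥0∞, Measurable h →
      ∫⁻ t in Ioi (0 : ℝ), u t * ⨆ s ∈ Ioi t, mass w t s ^ a * tail h s ^ r ≤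
        (C * ∫⁻ s in Ioi (0 : ℝ), h s * v s) ^ r)
    (s : ι → ℝ) (d : ι → ℝ≥0∞) (hd : ∀ i, d i ≠ ∞) (S : Finset ι) (K : ℝ≥0∞)
    (hK : ∀ η : ι → ℝ≥0∞, ∑ i ∈ S, d i * η i ≤
      K * ∫⁻ t in Ioi (0 : ℝ), u t * ⨆ i ∈ S, mass w t (s i) ^ a * η i)
    (l : ι → ℝ) (hl0 : ∀ i, 0 < l i) (hl : ∀ i, ENNReal.ofReal (l i) < tailSup v (s i)) :
    ∑ i ∈ S, (∑ j ∈ S with s j < s i, d j + d i) ^ (r / (1 - r)) * d i *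
      ENNReal.ofReal (l i) ^ (r / (1 - r)) ≤ (K * (C / ENNReal.ofReal r) ^ r) ^ (1 / (1 - r)) := by
  have hr : 0 < 1 - r := by linarith
  obtain ⟨h, hh, h1, h2⟩ := exists_test_sequence hr0 hr1 s (fun i => (d i).toReal) l
    (fun i => ENNReal.toReal_nonneg) hl0 S 0 le_rfl
  choose f hfm hf1 hf2 using fun i => exists_bump hv.1 (hl i)
  let g : ℝ → ℝ≥0∞ := fun y => ∑ i ∈ S, ENNReal.ofReal (h i) * f i y
  have hgm : Measurable g := Finset.measurable_sum _ fun i _ => (hfm i).const_mul _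
  have hgv : ∫⁻ y in Ioi (0 : ℝ), g y * v y ≤ ENNReal.ofReal (∑ i ∈ S, h i / l i) := by
    calc ∫⁻ y in Ioi (0 : ℝ), g y * v y
        = ∑ i ∈ S, ENNReal.ofReal (h i) * ∫⁻ y in Ioi (0 : ℝ), f i y * v y := by
          simp only [g, Finset.sum_mul, mul_assoc]
          have hm : ∀ i ∈ S, Measurable fun y => ENNReal.ofReal (h i) * (f i y * v y) :=
            fun i _ => ((hfm i).mul hv.1).const_mul _
          rw [lintegral_finsetSum _ hm]
          exact Finset.sum_congr rfl fun i _ => lintegral_const_mul _ ((hfm i).mul hv.1)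
      _ ≤ ∑ i ∈ S, ENNReal.ofReal (h i / l i) := by
          refine Finset.sum_le_sum fun i _ => ?_
          rw [ENNReal.ofReal_div_of_pos (hl0 i), ENNReal.div_eq_inv_mul, mul_comm]
          exact mul_le_mul_left (hf2 i) _
      _ = _ := (ENNReal.ofReal_sum_of_nonneg fun i _ => div_nonneg (hh i) (hl0 i).le).symm
  set H : ι → ℝ := fun i => ∑ j ∈ S with s i ≤ s j, h j
  have hH : ∀ i, 0 ≤ H i := fun i => Finset.sum_nonneg fun j _ => hh j
  have htail : ∀ i, ENNReal.ofReal (H i) ≤ tail g (s i) := by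
    intro i
    calc ENNReal.ofReal (H i) = ∑ j ∈ S with s i ≤ s j, ENNReal.ofReal (h j) :=
          ENNReal.ofReal_sum_of_nonneg fun j _ => hh j
      _ = ∑ j ∈ S with s i ≤ s j, ENNReal.ofReal (h j) * tail (f j) (s i) := by
          refine Finset.sum_congr rfl fun j hj => ?_
          rw [hf1 j _ (Finset.mem_filter.1 hj).2, mul_one]
      _ ≤ ∑ j ∈ S, ENNReal.ofReal (h j) * tail (f j) (s i) :=
          Finset.sum_le_sum_of_subset (Finset.filter_subset _ _)
      _ = tail g (s i) := by
          unfold tail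
          rw [lintegral_finsetSum _ fun i _ => (hfm i).const_mul _]
          exact (Finset.sum_congr rfl fun i _ => (lintegral_const_mul _ (hfm i))).symm
  set L : ℝ≥0∞ := ∑ i ∈ S, d i * ENNReal.ofReal (H i) ^ r
  have hLr : L = ENNReal.ofReal (∑ i ∈ S, (d i).toReal * H i ^ r) := by
    rw [ENNReal.ofReal_sum_of_nonneg fun i _ =>
      mul_nonneg ENNReal.toReal_nonneg (Real.rpow_nonneg (hH i) _)]
    refine Finset.sum_congr rfl fun i _ => ?_
    rw [ENNReal.ofReal_mul ENNReal.toReal_nonneg, ENNReal.ofReal_toReal (hd i),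
      ENNReal.ofReal_rpow_of_nonneg (hH i) hr0.le]
  have hLtop : L ≠ ∞ := hLr ▸ ENNReal.ofReal_ne_top
  have hcost : ENNReal.ofReal (∑ i ∈ S, h i / l i) ≤ L / ENNReal.ofReal r := by
    rw [hLr, ← ENNReal.ofReal_div_of_pos hr0]
    refine ENNReal.ofReal_le_ofReal ?_
    rw [le_div_iff₀ hr0]
    linarith
  have hLle : L ≤ (K * (C / ENNReal.ofReal r) ^ r) * L ^ r := by
    calc L ≤ ∑ i ∈ S, d i * tail g (s i) ^ r := by
          refine Finset.sum_le_sum fun i _ => ?_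
          gcongr
          exact htail i
      _ ≤ K * ∫⁻ t in Ioi (0 : ℝ), u t * ⨆ i ∈ S, mass w t (s i) ^ a * tail g (s i) ^ r :=
          hK _
      _ ≤ K * ∫⁻ t in Ioi (0 : ℝ), u t * ⨆ s ∈ Ioi t, mass w t s ^ a * tail g s ^ r := by
          gcongr with t
          refine iSup₂_le fun i _ => ?_
          rcases le_or_gt (s i) t with hst | hst
          · simp [mass_of_le hst, ENNReal.zero_rpow_of_pos ha]
          · exact le_iSup₂ (f := fun s (_ : s ∈ Ioi t) => mass w t s ^ a * tail g s ^ r) (s i) hst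
      _ ≤ K * (C * (L / ENNReal.ofReal r)) ^ r := by
          gcongr
          refine (hC g hgm).trans ?_
          gcongr
          exact hgv.trans hcost
      _ = _ := by
          rw [mul_assoc, ← ENNReal.mul_rpow_of_nonneg _ _ hr0.le]
          simp only [ENNReal.div_eq_inv_mul]
          congr 2
          ring
  refine le_trans (Finset.sum_le_sum fun i hi => ?_) (le_of_le_mul_rpow hr1 hLtop hLle)
  have hD : 0 ≤ 0 + ∑ j ∈ S with s j < s i, (d j).toReal + (d i).toReal :=
    add_nonneg (add_nonneg le_rfl (Finset.sum_nonneg fun j _ => ENNReal.toReal_nonneg))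
      ENNReal.toReal_nonneg
  have hDe : ∑ j ∈ S with s j < s i, d j + d i =
      ENNReal.ofReal (0 + ∑ j ∈ S with s j < s i, (d j).toReal + (d i).toReal) := by
    rw [zero_add, ENNReal.ofReal_add (Finset.sum_nonneg fun j _ => ENNReal.toReal_nonneg)
      ENNReal.toReal_nonneg, ENNReal.ofReal_sum_of_nonneg fun j _ => ENNReal.toReal_nonneg,
      ENNReal.ofReal_toReal (hd i)]
    congr 1
    exact Finset.sum_congr rfl fun j _ => (ENNReal.ofReal_toReal (hd j)).symm
  have hp : 0 ≤ r / (1 - r) := by positivity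
  rw [hDe, mul_right_comm, ← ENNReal.mul_rpow_of_nonneg _ _ hp, ← ENNReal.ofReal_mul hD, mul_comm,
    mul_comm _ (l i)]
  gcongr
  rw [ENNReal.ofReal_rpow_of_nonneg (mul_nonneg (hl0 i).le hD) hp,
    ENNReal.ofReal_rpow_of_nonneg (hH i) hr0.le]
  refine ENNReal.ofReal_le_ofReal ?_
  have := Real.rpow_le_rpow (Real.rpow_nonneg (mul_nonneg (hl0 i).le hD) _) (h1 i hi) hr0.le
  rwa [← Real.rpow_mul (mul_nonneg (hl0 i).le hD), one_div_mul_eq_div] at this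

theorem lower_hardy (hr0 : 0 < r) (hr1 : r < 1) (ha : 0 < a) (hv : IsWeight v)
    (hC : ∀ h : ℝ → ℝ≥0∞, Measurable h →
      ∫⁻ t in Ioi (0 : ℝ), u t * ⨆ s ∈ Ioi t, mass w t s ^ a * tail h s ^ r ≤
        (C * ∫⁻ s in Ioi (0 : ℝ), h s * v s) ^ r)
    (s : ι → ℝ) (d : ι → ℝ≥0∞) (hd : ∀ i, d i ≠ ∞) (S : Finset ι) (K : ℝ≥0∞)
    (hK : ∀ η : ι → ℝ≥0∞, ∑ i ∈ S, d i * η i ≤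
      K * ∫⁻ t in Ioi (0 : ℝ), u t * ⨆ i ∈ S, mass w t (s i) ^ a * η i) :
    ∑ i ∈ S, (∑ j ∈ S with s j < s i, d j + d i) ^ (r / (1 - r)) * d i *
      tailSup v (s i) ^ (r / (1 - r)) ≤ (K * (C / ENNReal.ofReal r) ^ r) ^ (1 / (1 - r)) := by
  have hp : 0 < r / (1 - r) := div_pos hr0 (by linarith)
  have hl : ∀ i, ∃ l : ℝ, 0 < l ∧ ENNReal.ofReal l < tailSup v (s i) := by
    intro i
    obtain ⟨x, h0x, hx⟩ := ENNReal.lt_iff_exists_nnreal_btwn.1 (tailSup_pos hv (s i))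
    exact ⟨x, by exact_mod_cast h0x, by simpa using hx⟩
  choose l hl0 hl using hl
  have hV : ∀ i, tailSup v (s i) ^ (r / (1 - r)) = _ := fun i =>
    (congrArg (· ^ (r / (1 - r))) (tailSup_eq_iSup (s i) (l i) (hl i))).trans (iSup_rpow _ hp)
  rw [Finset.sum_congr rfl fun i _ => by rw [hV i, ENNReal.mul_iSup]]
  refine sum_iSup_le S fun σ => lower_hardy_real hr0 hr1 ha hv hC s d hd S K hK _ ?_ ?_
  · intro i
    split_ifs with h
    · exact h.1
    · exact hl0 i
  · intro i
    split_ifs with h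
    · exact h.2
    · exact hl i

end lower
theorem exists_mass_eq {u : ℝ → ℝ≥0∞} (hu : IsWeight u) {t : ℝ} {c : ℝ≥0∞} (ht : 0 ≤ t)
    (hc0 : c ≠ 0) (hc : c ≤ mass u 0 t) : ∃ x, 0 < x ∧ mass u 0 x = c := by
  have hfin := mass_lt_top hu le_rfl t
  have hui : IntegrableOn (fun y => (u y).toReal) (Icc 0 t) := by
    rw [integrableOn_Icc_iff_integrableOn_Ioc]
    exact integrable_toReal_of_lintegral_ne_top hu.1.aemeasurable hfin.ne
  have hval : ∀ x, ∫ y in Ioc 0 x, (u y).toReal = (mass u 0 x).toReal := fun x =>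
    integral_toReal hu.1.aemeasurable (ae_lt_top hu.1 (mass_lt_top hu le_rfl x).ne)
  have hcont := intervalIntegral.continuousOn_primitive (μ := volume) hui
  simp_rw [hval] at hcont
  have hctop : c ≠ ∞ := ne_top_of_le_ne_top hfin.ne hc
  obtain ⟨x, hx, hxc⟩ := intermediate_value_Icc ht hcont
    (show c.toReal ∈ _ by
      constructor
      · simp [mass_of_le]
      · exact ENNReal.toReal_mono hfin.ne hc)
  have hxe : mass u 0 x = c := (ENNReal.toReal_eq_toReal_iff' (mass_lt_top hu le_rfl x).ne hctop).1 hxc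
  refine ⟨x, ?_, hxe⟩
  by_contra h
  exact hc0 (hxe ▸ mass_of_le (not_lt.1 h))

/-- `τ n`, for `n ∈ N`, are the points at which the primitive of `u` equals `lam ^ n`. -/
structure IsDyadic (u : ℝ → ℝ≥0∞) (lam : ℝ≥0∞) (N : Set ℤ) (τ : ℤ → ℝ) : Prop where
  nonneg : ∀ n, 0 ≤ τ n
  pos : ∀ n ∈ N, 0 < τ n
  mass_eq : ∀ n ∈ N, mass u 0 (τ n) = lam ^ n
  down : ∀ n ∈ N, ∀ m ≤ n, m ∈ N
  cover : ∀ t > 0, ∃ n ∈ N, lam ^ n < mass u 0 t ∧ mass u 0 t ≤ lam ^ (n + 1)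

theorem exists_isDyadic {u : ℝ → ℝ≥0∞} (hu : IsWeight u) {lam : ℝ≥0∞} (hlam : 1 < lam)
    (hlam' : lam ≠ ∞) : ∃ N τ, IsDyadic u lam N τ := by
  have h0 : ∀ n : ℤ, lam ^ n ≠ 0 := fun n => (ENNReal.zpow_pos (pos_of_gt hlam).ne' hlam' n).ne'
  classical
  let N : Set ℤ := {n | ∃ t, 0 < t ∧ mass u 0 t = lam ^ n}
  refine ⟨N, fun n => if h : n ∈ N then h.choose else 0, ?_, ?_, ?_, ?_, ?_⟩
  · intro n
    split_ifs with h
    · exact h.choose_spec.1.le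
    · exact le_rfl
  · intro n hn
    rw [dif_pos hn]
    exact hn.choose_spec.1
  · intro n hn
    rw [dif_pos hn]
    exact hn.choose_spec.2
  · rintro n ⟨t, ht, hn⟩ m hm
    exact exists_mass_eq hu ht.le (h0 m) (hn ▸ ENNReal.monotone_zpow hlam.le hm)
  · intro t ht
    obtain ⟨n, hn, hn'⟩ := ENNReal.exists_mem_Ioc_zpow (hu.2 t ht).1.ne'
      (mass_lt_top hu le_rfl t).ne hlam hlam'
    exact ⟨n, exists_mass_eq hu ht.le (h0 n) hn.le, hn, hn'⟩

section dyadic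

variable {u : ℝ → ℝ≥0∞} {lam : ℝ≥0∞} {N : Set ℤ} {τ : ℤ → ℝ}

theorem IsDyadic.lt_of_lt (hD : IsDyadic u lam N τ) {n : ℤ} (hn : n ∈ N) {t : ℝ}
    (h : lam ^ n < mass u 0 t) : τ n < t := by
  by_contra hc
  exact ((mass_mono le_rfl (not_lt.1 hc)).trans_eq (hD.mass_eq n hn)).not_gt h

theorem zpow_succ' (hlam : 1 < lam) (hlam' : lam ≠ ∞) (n : ℤ) : lam ^ (n + 1) = lam * lam ^ n := by
  rw [ENNReal.zpow_add (pos_of_gt hlam).ne' hlam', zpow_one, mul_comm]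

theorem zpow_ne_top' (hlam : 1 < lam) (hlam' : lam ≠ ∞) (n : ℤ) : lam ^ n ≠ ∞ :=
  (ENNReal.zpow_lt_top (pos_of_gt hlam).ne' hlam' n).ne

theorem IsDyadic.le_succ (hD : IsDyadic u lam N τ) (hlam : 1 < lam) (hlam' : lam ≠ ∞) {n : ℤ}
    (hn : n + 1 ∈ N) : τ n ≤ τ (n + 1) := by
  refine (hD.lt_of_lt (hD.down _ hn n (by lia)) ?_).le
  rw [hD.mass_eq _ hn, zpow_succ' hlam hlam']
  calc lam ^ n = 1 * lam ^ n := (one_mul _).symm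
    _ < _ := (ENNReal.mul_lt_mul_iff_left (ENNReal.zpow_pos (pos_of_gt hlam).ne' hlam' n).ne'
      (zpow_ne_top' hlam hlam' n)).2 hlam

theorem IsDyadic.mono (hD : IsDyadic u lam N τ) (hlam : 1 < lam) (hlam' : lam ≠ ∞) {m n : ℤ}
    (hn : n ∈ N) (hmn : m ≤ n) : τ m ≤ τ n := by
  induction n, hmn using Int.leInduction with
  | base => exact le_rfl
  | succ n hmn ih => exact (ih (hD.down _ hn n (by lia))).trans (hD.le_succ hlam hlam' hn)

theorem IsDyadic.mass_block (hD : IsDyadic u lam N τ) (hlam : 1 < lam) (hlam' : lam ≠ ∞) {n : ℤ}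
    (hn : n + 1 ∈ N) : lam ^ n + mass u (τ n) (τ (n + 1)) = lam * lam ^ n := by
  rw [← zpow_succ' hlam hlam', ← hD.mass_eq _ hn, ← hD.mass_eq n (hD.down _ hn n (by lia))]
  exact mass_add u (hD.nonneg n) (hD.le_succ hlam hlam' hn)

theorem IsDyadic.zpow_le_mass (hD : IsDyadic u lam N τ) (hlam : 2 ≤ lam) (hlam' : lam ≠ ∞) {n : ℤ}
    (hn : n + 1 ∈ N) : lam ^ n ≤ mass u (τ n) (τ (n + 1)) := by
  have h1 : 1 < lam := ENNReal.one_lt_two.trans_le hlam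
  rw [← ENNReal.add_le_add_iff_left (zpow_ne_top' h1 hlam' n), hD.mass_block h1 hlam' hn, ← two_mul]
  exact mul_le_mul_left hlam _

theorem IsDyadic.mass_block_succ (hD : IsDyadic u lam N τ) (hlam : 1 < lam) (hlam' : lam ≠ ∞)
    {n : ℤ} (hn : n + 1 + 1 ∈ N) :
    lam * mass u (τ n) (τ (n + 1)) = mass u (τ (n + 1)) (τ (n + 1 + 1)) := by
  have h1 := hD.mass_block hlam hlam' hn
  have h2 := hD.mass_block hlam hlam' (hD.down _ hn (n + 1) (by lia))
  rw [zpow_succ' hlam hlam'] at h1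
  rw [← ENNReal.add_right_inj (a := lam * lam ^ n)
    (ENNReal.mul_ne_top hlam' (zpow_ne_top' hlam hlam' n)), h1, ← mul_add, h2]

theorem IsDyadic.disjoint_block (hD : IsDyadic u lam N τ) (hlam : 1 < lam) (hlam' : lam ≠ ∞)
    {m n : ℤ} (hm : m ∈ N) (hn : n ∈ N) (hmn : m ≠ n) :
    Disjoint (Ioc (τ (m - 1)) (τ m)) (Ioc (τ (n - 1)) (τ n)) := by
  rcases lt_or_gt_of_ne hmn with h | h
  · refine Set.disjoint_left.2 fun x hx hx' => ?_
    have := hD.mono hlam hlam' (hD.down n hn (n - 1) (by lia)) (show m ≤ n - 1 by lia)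
    linarith [hx.2, hx'.1]
  · refine Set.disjoint_left.2 fun x hx hx' => ?_
    have := hD.mono hlam hlam' (hD.down m hm (m - 1) (by lia)) (show n ≤ m - 1 by lia)
    linarith [hx.1, hx'.2]

theorem IsDyadic.lintegral_le (hD : IsDyadic u lam N τ) (f : ℝ → ℝ≥0∞) {B : ℝ≥0∞}
    (h : ∀ F : Finset ℤ, (∀ n ∈ F, n ∈ N) →
      ∑ n ∈ F, ∫⁻ t in {t | 0 < t ∧ lam ^ n < mass u 0 t ∧ mass u 0 t ≤ lam ^ (n + 1)}, f t ≤ B) :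
    ∫⁻ t in Ioi (0 : ℝ), f t ≤ B := by
  classical
  have hsub : Ioi (0 : ℝ) ⊆ ⋃ n : N,
      {t | 0 < t ∧ lam ^ (n : ℤ) < mass u 0 t ∧ mass u 0 t ≤ lam ^ ((n : ℤ) + 1)} := by
    intro t ht
    obtain ⟨n, hn, h1, h2⟩ := hD.cover t ht
    exact mem_iUnion.2 ⟨⟨n, hn⟩, ht, h1, h2⟩
  refine (lintegral_mono_set hsub).trans ((lintegral_iUnion_le _ _).trans ?_)
  rw [ENNReal.tsum_eq_iSup_sum]
  refine iSup_le fun F => ?_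
  have := h (F.map (Function.Embedding.subtype _)) (by simp +contextual)
  rwa [Finset.sum_map] at this

end dyadic

theorem sum_block_le {ι : Type*} {u w : ℝ → ℝ≥0∞} (hu : Measurable u) {a : ℝ}
    (S : Finset ι) (B : ι → Set ℝ) (hB : ∀ i ∈ S, MeasurableSet (B i))
    (hB0 : ∀ i ∈ S, B i ⊆ Ioi 0) (hd : (S : Set ι).PairwiseDisjoint B) (s : ι → ℝ) (η : ι → ℝ≥0∞)
    (g : ℝ → ℝ≥0∞) (hg : ∀ i ∈ S, ∀ t, mass w t (s i) ^ a * η i ≤ g t) :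
    ∑ i ∈ S, (∫⁻ x in B i, u x * mass w x (s i) ^ a) * η i ≤ ∫⁻ t in Ioi (0 : ℝ), u t * g t := by
  calc ∑ i ∈ S, (∫⁻ x in B i, u x * mass w x (s i) ^ a) * η i
      ≤ ∑ i ∈ S, ∫⁻ x in B i, u x * g x := by
        refine Finset.sum_le_sum fun i hi => ?_
        have hm : Measurable fun x => u x * mass w x (s i) ^ a :=
          hu.mul ((measurable_mass_left w (s i)).pow_const a)
        rw [← lintegral_mul_const _ hm]
        refine lintegral_mono fun x => ?_
        rw [mul_assoc]
        exact mul_le_mul_right (hg i hi x) _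
    _ = ∫⁻ x in ⋃ i ∈ S, B i, u x * g x := (lintegral_biUnion_finset hd hB _).symm
    _ ≤ _ := lintegral_mono_set (iUnion₂_subset hB0)
theorem mass_absorb {u w : ℝ → ℝ≥0∞} (hu : IsWeight u) (hw : IsWeight w) {a : ℝ} (ha : 0 ≤ a)
    {b : ℕ → ℝ} (hb : Antitone b) (hb0 : ∀ j, 0 ≤ b j) (hlim : ∀ x > 0, ∃ j, b j < x)
    (hmass : ∀ j, 2 * 2 ^ a * mass u (b (j + 2)) (b (j + 1)) ≤ mass u (b (j + 1)) (b j))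
    {t : ℝ} (ht : b 0 ≤ t) :
    mass (fun x => u x * mass w x t ^ a) 0 t ≤
      2 * 2 ^ a * ∑' j : ℕ, mass (fun x => u x * mass w x (b j) ^ a) (b (j + 2)) (b (j + 1)) +
        2 * (mass u 0 t * mass w (b 1) t ^ a) := by
  set f : ℝ → ℝ≥0∞ := fun x => u x * mass w x t ^ a
  set κ : ℕ → ℝ≥0∞ := fun j => mass (fun x => u x * mass w x (b j) ^ a) (b (j + 2)) (b (j + 1))
  set J : ℕ → ℝ≥0∞ := fun j => mass f (b (j + 1)) (b j)
  set R := mass u 0 t * mass w (b 1) t ^ a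
  have hR : mass f (b 1) t ≤ R := by
    calc mass f (b 1) t ≤ ∫⁻ x in Ioc (b 1) t, u x * mass w (b 1) t ^ a := by
          refine setLIntegral_mono (hu.1.mul_const _) fun x hx => ?_
          dsimp only [f]
          gcongr
          exact mass_mono hx.1.le le_rfl
      _ = mass u (b 1) t * mass w (b 1) t ^ a := lintegral_mul_const _ hu.1
      _ ≤ R := by
          dsimp only [R]
          gcongr
          exact mass_mono (hb0 1) le_rfl
  have hX : mass f 0 (b 1) = ∑' j, J (j + 1) := by
    have hset : Ioc 0 (b 1) = ⋃ j : ℕ, Ioc (b (j + 1 + 1)) (b (j + 1)) := by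
      ext x
      simp only [mem_iUnion, mem_Ioc]
      constructor
      · rintro ⟨hx0, hx1⟩
        have hex : ∃ j, b (j + 1 + 1) < x := by
          obtain ⟨j, hj⟩ := hlim x hx0
          exact ⟨j, (hb (by lia)).trans_lt hj⟩
        classical
        refine ⟨Nat.find hex, Nat.find_spec hex, ?_⟩
        rcases h : Nat.find hex with _ | k
        · exact hx1
        · exact not_lt.1 (Nat.find_min hex (m := k) (by lia))
      · rintro ⟨j, h1, h2⟩
        exact ⟨(hb0 _).trans_lt h1, h2.trans (hb (by lia))⟩
    rw [mass, hset, lintegral_iUnion (fun _ => measurableSet_Ioc)]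
    · rfl
    exact (hb.comp_monotone fun _ _ h => Nat.succ_le_succ h).pairwise_disjoint_on_Ioc_succ
  have hXtop : mass f 0 (b 1) ≠ ∞ := by
    have : mass f 0 (b 1) ≤ mass u 0 (b 1) * mass w 0 t ^ a := by
      rw [mass, mass, ← lintegral_mul_const _ hu.1]
      refine setLIntegral_mono (hu.1.mul_const _) fun x hx => ?_
      dsimp only [f]
      gcongr
      exact mass_mono hx.1.le le_rfl
    refine ne_top_of_le_ne_top (ENNReal.mul_ne_top (mass_lt_top hu le_rfl _).ne ?_) this
    exact ENNReal.rpow_ne_top_of_nonneg ha (mass_lt_top hw le_rfl _).ne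
  have hstep : ∀ j, 2 * J (j + 1) ≤ 2 * 2 ^ a * κ j + J j := by
    intro j
    have h1 : J (j + 1) ≤ 2 ^ a * (κ j + mass u (b (j + 2)) (b (j + 1)) * mass w (b j) t ^ a) := by
      have hm : Measurable fun x => u x * mass w x (b j) ^ a :=
        hu.1.mul ((measurable_mass_left w _).pow_const a)
      calc J (j + 1) ≤ ∫⁻ x in Ioc (b (j + 2)) (b (j + 1)),
            2 ^ a * (u x * mass w x (b j) ^ a + u x * mass w (b j) t ^ a) := by
            refine lintegral_mono fun x => ?_
            calc f x ≤ u x * (mass w x (b j) + mass w (b j) t) ^ a := by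
                  dsimp only [f]
                  gcongr
                  exact mass_le_add w x (b j) t
              _ ≤ u x * (2 ^ a * (mass w x (b j) ^ a + mass w (b j) t ^ a)) := by
                  gcongr
                  exact add_rpow_le_two _ _ ha
              _ = _ := by ring
        _ = _ := by
            have hm' : Measurable fun x => u x * mass w x (b j) ^ a + u x * mass w (b j) t ^ a :=
              hm.add (hu.1.mul_const _)
            rw [lintegral_const_mul _ hm', lintegral_add_left hm,
              lintegral_mul_const _ hu.1]
            rfl
    have h2 : mass u (b (j + 1)) (b j) * mass w (b j) t ^ a ≤ J j := by
      rw [mass, ← lintegral_mul_const _ hu.1]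
      refine setLIntegral_mono (hu.1.mul ((measurable_mass_left w _).pow_const a)) fun x hx => ?_
      exact mul_le_mul_right (ENNReal.rpow_le_rpow (mass_mono hx.2 le_rfl) ha) _
    calc 2 * J (j + 1)
        ≤ 2 * (2 ^ a * (κ j + mass u (b (j + 2)) (b (j + 1)) * mass w (b j) t ^ a)) := by gcongr
      _ = 2 * 2 ^ a * κ j + 2 * 2 ^ a * mass u (b (j + 2)) (b (j + 1)) * mass w (b j) t ^ a := by
          ring
      _ ≤ 2 * 2 ^ a * κ j + mass u (b (j + 1)) (b j) * mass w (b j) t ^ a := by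
          gcongr
          exact hmass j
      _ ≤ _ := by gcongr
  have hsum : mass f 0 (b 1) + mass f 0 (b 1) ≤
      mass f 0 (b 1) + (2 * 2 ^ a * ∑' j, κ j + R) := by
    calc mass f 0 (b 1) + mass f 0 (b 1) = ∑' j, 2 * J (j + 1) := by
          rw [ENNReal.tsum_mul_left, ← hX, two_mul]
      _ ≤ ∑' j, (2 * 2 ^ a * κ j + J j) := ENNReal.tsum_le_tsum hstep
      _ = 2 * 2 ^ a * ∑' j, κ j + (J 0 + ∑' j, J (j + 1)) := by
          rw [ENNReal.tsum_add, ENNReal.tsum_mul_left, tsum_eq_zero_add' (f := J) ENNReal.summable]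
      _ ≤ 2 * 2 ^ a * ∑' j, κ j + (R + mass f 0 (b 1)) := by
          rw [← hX]
          gcongr
          exact (mass_mono le_rfl ht).trans hR
      _ = _ := by ring
  have hX2 := (ENNReal.add_le_add_iff_left hXtop).1 hsum
  calc mass f 0 t ≤ mass f 0 (b 1) + mass f (b 1) t := mass_le_add f 0 (b 1) t
    _ ≤ (2 * 2 ^ a * ∑' j, κ j + R) + R := add_le_add hX2 hR
    _ = _ := by ring

theorem IsDyadic.zpow_le_two_mul {u : ℝ → ℝ≥0∞} {lam : ℝ≥0∞} {N : Set ℤ} {τ : ℤ → ℝ}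
    (hD : IsDyadic u lam N τ) (hlam : 2 ≤ lam) (hlam' : lam ≠ ∞) {n : ℤ}
    (hn : n ∈ N) : lam ^ n ≤ 2 * mass u (τ (n - 1)) (τ n) := by
  obtain ⟨m, rfl⟩ : ∃ m, n = m + 1 := ⟨n - 1, by ring⟩
  have h1 : 1 < lam := ENNReal.one_lt_two.trans_le hlam
  rw [add_sub_cancel_right, zpow_succ' h1 hlam', ← hD.mass_block h1 hlam' hn, two_mul]
  gcongr
  exact hD.zpow_le_mass hlam hlam' hn

section necessity

variable {r a : ℝ} {u v w : ℝ → ℝ≥0∞} {C : ℝ≥0∞} {lam : ℝ≥0∞} {N : Set ℤ} {τ : ℤ → ℝ}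

theorem block_ne_top (hu : IsWeight u) (hw : IsWeight w) (ha : 0 < a) {x y : ℝ} (hx : 0 ≤ x)
    (s : ℝ) : mass (fun x => u x * mass w x s ^ a) x y ≠ ∞ := by
  have : mass (fun x => u x * mass w x s ^ a) x y ≤ mass u x y * mass w 0 s ^ a := by
    rw [mass, mass, ← lintegral_mul_const _ hu.1]
    refine setLIntegral_mono (hu.1.mul_const _) fun z hz => ?_
    gcongr
    exact mass_mono (hx.trans hz.1.le) le_rfl
  refine ne_top_of_le_ne_top (ENNReal.mul_ne_top (mass_lt_top hu hx _).ne ?_) this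
  exact ENNReal.rpow_ne_top_of_nonneg ha.le (mass_lt_top hw le_rfl _).ne

theorem zpow_mul_le_block (hu : IsWeight u) (ha : 0 < a) (hlam : 2 ≤ lam)
    (hlam' : lam ≠ ∞) (hD : IsDyadic u lam N τ) {n : ℤ} (hn : n ∈ N) (s : ℝ) :
    lam ^ n * mass w (τ n) s ^ a ≤
      2 * mass (fun x => u x * mass w x s ^ a) (τ (n - 1)) (τ n) := by
  calc lam ^ n * mass w (τ n) s ^ a ≤ 2 * mass u (τ (n - 1)) (τ n) * mass w (τ n) s ^ a := by
        gcongr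
        exact hD.zpow_le_two_mul hlam hlam' hn
    _ ≤ _ := by
        rw [mul_assoc]
        gcongr
        rw [mass, ← lintegral_mul_const _ hu.1]
        refine setLIntegral_mono (hu.1.mul ((measurable_mass_left w _).pow_const a)) fun x hx => ?_
        gcongr
        exact mass_mono hx.2 le_rfl

theorem sum_zpow_supWeight_le (hr0 : 0 < r) (hr1 : r < 1) (ha : 0 < a) (hu : IsWeight u)
    (hv : IsWeight v) (hw : IsWeight w)
    (hC : ∀ h : ℝ → ℝ≥0∞, Measurable h →
      ∫⁻ t in Ioi (0 : ℝ), u t * ⨆ s ∈ Ioi t, mass w t s ^ a * tail h s ^ r ≤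
        (C * ∫⁻ s in Ioi (0 : ℝ), h s * v s) ^ r)
    (hlam : 2 ≤ lam) (hlam' : lam ≠ ∞) (hD : IsDyadic u lam N τ)
    (F : Finset ℤ) (hF : ∀ n ∈ F, n ∈ N) :
    ∑ n ∈ F, (lam ^ n) ^ (r / (1 - r) + 1) *
        supWeight w v (a * (r / (1 - r) + 1)) (r / (1 - r)) (τ n) ≤
      2 ^ (r / (1 - r) + 1) * (1 * (C / ENNReal.ofReal r) ^ r) ^ (1 / (1 - r)) := by
  have h1 : 1 < lam := ENNReal.one_lt_two.trans_le hlam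
  have hp : 0 < r / (1 - r) := div_pos hr0 (by linarith)
  set p := r / (1 - r)
  simp only [supWeight, ENNReal.mul_iSup]
  refine sum_iSup_le F fun σ => ?_
  have L := lower_hardy hr0 hr1 ha hv hC (fun n => (σ n : ℝ))
    (fun n => mass (fun x => u x * mass w x (σ n) ^ a) (τ (n - 1)) (τ n))
    (fun n => block_ne_top hu hw ha (hD.nonneg _) _) F 1 (fun η => by
      rw [one_mul]
      refine sum_block_le hu.1 F (fun n => Ioc (τ (n - 1)) (τ n)) (fun _ _ => measurableSet_Ioc)
        (fun n _ x hx => (hD.nonneg _).trans_lt hx.1) ?_ _ η _ fun i hi t =>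
          le_iSup₂ (f := fun i (_ : i ∈ F) => mass w t (σ i) ^ a * η i) i hi
      intro m hm n hn hmn
      exact hD.disjoint_block h1 hlam' (hF m hm) (hF n hn) hmn)
  refine le_trans ?_ (mul_le_mul_right L _)
  rw [Finset.mul_sum]
  refine Finset.sum_le_sum fun n hn => ?_
  rw [← mul_assoc, ← mul_assoc, ENNReal.rpow_mul, ← ENNReal.mul_rpow_of_nonneg _ _ (by positivity)]
  gcongr
  refine (ENNReal.rpow_le_rpow (zpow_mul_le_block hu ha hlam hlam' hD (hF n hn) _)
    (by positivity)).trans ?_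
  rw [ENNReal.mul_rpow_of_nonneg _ _ (by positivity), ENNReal.rpow_add_of_nonneg p 1 hp.le zero_le_one
    (x := mass _ _ _), ENNReal.rpow_one]
  gcongr
  exact le_add_self

theorem sum_tsum_supWeight_le (hr0 : 0 < r) (hr1 : r < 1) (ha : 0 < a) (hu : IsWeight u)
    (hv : IsWeight v) (hw : IsWeight w)
    (hC : ∀ h : ℝ → ℝ≥0∞, Measurable h →
      ∫⁻ t in Ioi (0 : ℝ), u t * ⨆ s ∈ Ioi t, mass w t s ^ a * tail h s ^ r ≤
        (C * ∫⁻ s in Ioi (0 : ℝ), h s * v s) ^ r)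
    (hlam : 2 ≤ lam) (hlam' : lam ≠ ∞) (hD : IsDyadic u lam N τ)
    (F : Finset ℤ) (hF : ∀ n ∈ F, n ∈ N) (κ : ℤ → ℝ≥0∞)
    (hκ : ∀ m, κ m = mass (fun x => u x * mass w x (τ (m + 1)) ^ a) (τ (m - 1)) (τ m)) :
    ∑ n ∈ F, (∑' j : ℕ, κ (n - 1 - j)) ^ (r / (1 - r)) * lam ^ n *
        supWeight w v a (r / (1 - r)) (τ n) ≤
      2 * (2 * (C / ENNReal.ofReal r) ^ r) ^ (1 / (1 - r)) := by
  classical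
  have h1 : 1 < lam := ENNReal.one_lt_two.trans_le hlam
  have hp : 0 < r / (1 - r) := div_pos hr0 (by linarith)
  set p := r / (1 - r)
  have hsup : ∀ n, (∑' j : ℕ, κ (n - 1 - j)) ^ p * lam ^ n * supWeight w v a p (τ n) ≤
      ⨆ x : ℕ × ℚ, (∑ j ∈ Finset.range x.1, κ (n - 1 - j)) ^ p * lam ^ n *
        (mass w (τ n) x.2 ^ a * tailSup v x.2 ^ p) := by
    intro n
    rw [ENNReal.tsum_eq_iSup_nat, iSup_rpow _ hp, ENNReal.iSup_mul, ENNReal.iSup_mul]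
    refine iSup_le fun M => ?_
    rw [supWeight, ENNReal.mul_iSup]
    exact iSup_le fun s => le_iSup (fun x : ℕ × ℚ => (∑ j ∈ Finset.range x.1, κ (n - 1 - j)) ^ p *
      lam ^ n * (mass w (τ n) x.2 ^ a * tailSup v x.2 ^ p)) (M, s)
  refine (Finset.sum_le_sum fun n _ => hsup n).trans (sum_iSup_le F fun σ => ?_)
  let S₂ : Finset ℤ := F.biUnion fun n => (Finset.range (σ n).1).image fun j : ℕ => n - 1 - j
  have hS₂ : ∀ m ∈ S₂, m ∈ N := by
    intro m hm
    simp only [S₂, Finset.mem_biUnion, Finset.mem_image] at hm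
    obtain ⟨n, hn, j, _, rfl⟩ := hm
    exact hD.down n (hF n hn) _ (by lia)
  let s : ℤ ⊕ ℤ → ℝ := Sum.elim (fun n => ((σ n).2 : ℝ)) (fun m => τ (m + 1))
  let d : ℤ ⊕ ℤ → ℝ≥0∞ := Sum.elim
    (fun n => mass (fun x => u x * mass w x (σ n).2 ^ a) (τ (n - 1)) (τ n)) κ
  have L := lower_hardy hr0 hr1 ha hv hC s d
    (by
      rintro (n | m)
      · exact block_ne_top hu hw ha (hD.nonneg _) _
      · simp only [d, Sum.elim_inr, hκ]
        exact block_ne_top hu hw ha (hD.nonneg _) _) (F.disjSum S₂) 2 (fun η => by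
      rw [Finset.sum_disjSum, two_mul]
      refine add_le_add ?_ ?_
      · refine sum_block_le hu.1 F (fun n => Ioc (τ (n - 1)) (τ n)) (fun _ _ => measurableSet_Ioc)
          (fun n _ x hx => (hD.nonneg _).trans_lt hx.1) ?_ _ (fun n => η (Sum.inl n)) _ fun i hi t =>
            le_iSup₂ (f := fun i (_ : i ∈ F.disjSum S₂) => mass w t (s i) ^ a * η i) (Sum.inl i)
              (Finset.inl_mem_disjSum.2 hi)
        intro m hm n hn hmn
        exact hD.disjoint_block h1 hlam' (hF m hm) (hF n hn) hmn
      · simp only [d, Sum.elim_inr, hκ]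
        refine sum_block_le hu.1 S₂ (fun n => Ioc (τ (n - 1)) (τ n)) (fun _ _ => measurableSet_Ioc)
          (fun n _ x hx => (hD.nonneg _).trans_lt hx.1) ?_ _ (fun n => η (Sum.inr n)) _ fun i hi t =>
            le_iSup₂ (f := fun i (_ : i ∈ F.disjSum S₂) => mass w t (s i) ^ a * η i) (Sum.inr i)
              (Finset.inr_mem_disjSum.2 hi)
        intro m hm n hn hmn
        exact hD.disjoint_block h1 hlam' (hS₂ m hm) (hS₂ n hn) hmn)
  rw [Finset.sum_disjSum] at L
  refine le_trans ?_ (mul_le_mul_right (le_self_add.trans L) _)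
  rw [Finset.mul_sum]
  refine Finset.sum_le_sum fun n hn => ?_
  rcases le_or_gt ((σ n).2 : ℝ) (τ n) with hs | hs
  · simp [mass_of_le hs, ENNReal.zero_rpow_of_pos ha]
  have hsub : ∑ j ∈ Finset.range (σ n).1, κ (n - 1 - j) ≤
      ∑ i ∈ F.disjSum S₂ with s i < s (Sum.inl n), d i := by
    have hinj : Function.Injective fun j : ℕ => (Sum.inr (n - 1 - (j : ℤ)) : ℤ ⊕ ℤ) := by
      intro i j hij
      have := Sum.inr.inj hij
      lia
    calc ∑ j ∈ Finset.range (σ n).1, κ (n - 1 - j)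
        = ∑ i ∈ (Finset.range (σ n).1).map ⟨_, hinj⟩, d i := by
          rw [Finset.sum_map]
          rfl
      _ ≤ _ := by
          refine Finset.sum_le_sum_of_subset ?_
          intro i hi
          obtain ⟨j, hj, rfl⟩ := Finset.mem_map.1 hi
          refine Finset.mem_filter.2 ⟨Finset.inr_mem_disjSum.2 ?_, ?_⟩
          · exact Finset.mem_biUnion.2 ⟨n, hn, Finset.mem_image.2 ⟨j, hj, rfl⟩⟩
          · exact (hD.mono h1 hlam' (hF n hn) (by lia)).trans_lt hs
  calc (∑ j ∈ Finset.range (σ n).1, κ (n - 1 - j)) ^ p * lam ^ n *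
        (mass w (τ n) (σ n).2 ^ a * tailSup v (σ n).2 ^ p)
      = (∑ j ∈ Finset.range (σ n).1, κ (n - 1 - j)) ^ p *
        (lam ^ n * mass w (τ n) (σ n).2 ^ a) * tailSup v (σ n).2 ^ p := by ring
    _ ≤ (∑ i ∈ F.disjSum S₂ with s i < s (Sum.inl n), d i + d (Sum.inl n)) ^ p *
        (2 * d (Sum.inl n)) * tailSup v (σ n).2 ^ p := by
        refine mul_le_mul_left (mul_le_mul' ?_ ?_) _
        · exact ENNReal.rpow_le_rpow (hsub.trans le_self_add) hp.le
        · exact zpow_mul_le_block hu ha hlam hlam' hD (hF n hn) _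
    _ = 2 * ((∑ i ∈ F.disjSum S₂ with s i < s (Sum.inl n), d i + d (Sum.inl n)) ^ p *
        d (Sum.inl n) * tailSup v (s (Sum.inl n)) ^ p) := by
        simp only [s, Sum.elim_inl]
        ring

theorem lintegral_level_le (hu : Measurable u) {f : ℝ → ℝ≥0∞} (c : ℝ≥0∞) (n : ℤ)
    (h : ∀ t, 0 < t → lam ^ n < mass u 0 t → mass u 0 t ≤ lam ^ (n + 1) → f t ≤ u t * c) :
    ∫⁻ t in {t | 0 < t ∧ lam ^ n < mass u 0 t ∧ mass u 0 t ≤ lam ^ (n + 1)}, f t ≤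
      lam ^ (n + 1) * c := by
  calc _ ≤ ∫⁻ t in {t | 0 < t ∧ lam ^ n < mass u 0 t ∧ mass u 0 t ≤ lam ^ (n + 1)}, u t * c :=
        setLIntegral_mono (hu.mul_const _) fun t ht => h t ht.1 ht.2.1 ht.2.2
    _ ≤ ∫⁻ t in {t | 0 < t ∧ mass u 0 t ≤ lam ^ (n + 1)}, u t * c :=
        lintegral_mono_set fun t ht => ⟨ht.1, ht.2.2⟩
    _ ≤ _ := by
        rw [lintegral_mul_const _ hu]
        gcongr
        exact lintegral_mass_sublevel_le u _

theorem lintegral_mass_supWeight_le (hr0 : 0 < r) (hr1 : r < 1) (ha : 0 < a) (hu : IsWeight u)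
    (hv : IsWeight v) (hw : IsWeight w)
    (hC : ∀ h : ℝ → ℝ≥0∞, Measurable h →
      ∫⁻ t in Ioi (0 : ℝ), u t * ⨆ s ∈ Ioi t, mass w t s ^ a * tail h s ^ r ≤
        (C * ∫⁻ s in Ioi (0 : ℝ), h s * v s) ^ r)
    (hlam : 2 ≤ lam) (hlam' : lam ≠ ∞) (hD : IsDyadic u lam N τ) :
    ∫⁻ t in Ioi (0 : ℝ), mass u 0 t ^ (r / (1 - r)) * u t *
        supWeight w v (a * (r / (1 - r) + 1)) (r / (1 - r)) t ≤
      lam ^ (r / (1 - r) + 1) *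
        (2 ^ (r / (1 - r) + 1) * (1 * (C / ENNReal.ofReal r) ^ r) ^ (1 / (1 - r))) := by
  have h1 : 1 < lam := ENNReal.one_lt_two.trans_le hlam
  have hp : 0 < r / (1 - r) := div_pos hr0 (by linarith)
  refine hD.lintegral_le _ fun F hF => ?_
  refine le_trans ?_ (mul_le_mul_right
    (sum_zpow_supWeight_le hr0 hr1 ha hu hv hw hC hlam hlam' hD F hF) _)
  rw [Finset.mul_sum]
  refine Finset.sum_le_sum fun n hn => ?_
  set p := r / (1 - r)
  refine (lintegral_level_le hu.1 ((lam ^ (n + 1)) ^ p * supWeight w v (a * (p + 1)) p (τ n)) n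
    fun t _ h2 h3 => ?_).trans (le_of_eq ?_)
  · rw [mul_comm _ (u t), mul_assoc]
    gcongr
    exact supWeight_anti w v (by positivity) p (hD.lt_of_lt (hF n hn) h2).le
  · rw [← mul_assoc, ← mul_assoc, ← ENNReal.mul_rpow_of_nonneg _ _ (by positivity),
      ← zpow_succ' h1 hlam', ENNReal.rpow_add_of_nonneg p 1 hp.le zero_le_one, ENNReal.rpow_one,
      mul_comm (lam ^ (n + 1)) (_ ^ p)]

theorem IsDyadic.exists_lt (hD : IsDyadic u lam N τ) (hlam : 1 < lam) (hlam' : lam ≠ ∞) (n : ℤ)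
    {x : ℝ} (hx : 0 < x) : ∃ j : ℕ, τ (n - j) < x := by
  obtain ⟨m, hm, hmx, _⟩ := hD.cover x hx
  have h := hD.lt_of_lt hm hmx
  refine ⟨(n - m).toNat, (hD.mono hlam hlam' hm ?_).trans_lt h⟩
  lia

theorem lintegral_absorb_supWeight_le (hr0 : 0 < r) (hr1 : r < 1) (ha : 0 < a) (hu : IsWeight u)
    (hv : IsWeight v) (hw : IsWeight w)
    (hC : ∀ h : ℝ → ℝ≥0∞, Measurable h →
      ∫⁻ t in Ioi (0 : ℝ), u t * ⨆ s ∈ Ioi t, mass w t s ^ a * tail h s ^ r ≤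
        (C * ∫⁻ s in Ioi (0 : ℝ), h s * v s) ^ r)
    (hlam : lam = 2 * 2 ^ a) (hD : IsDyadic u lam N τ) :
    ∫⁻ t in Ioi (0 : ℝ), mass (fun x => u x * mass w x t ^ a) 0 t ^ (r / (1 - r)) * u t *
        supWeight w v a (r / (1 - r)) t ≤
      2 ^ (r / (1 - r)) * lam ^ (r / (1 - r)) * lam *
        (2 * (2 * (C / ENNReal.ofReal r) ^ r) ^ (1 / (1 - r))) +
      2 ^ (r / (1 - r)) * 2 ^ (r / (1 - r)) * (lam * lam) ^ (r / (1 - r) + 1) *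
        (2 ^ (r / (1 - r) + 1) * (1 * (C / ENNReal.ofReal r) ^ r) ^ (1 / (1 - r))) := by
  have hlam2 : 2 ≤ lam := by
    rw [hlam]
    exact le_mul_of_one_le_right zero_le (ENNReal.one_le_rpow one_le_two ha)
  have hlam' : lam ≠ ∞ := by
    rw [hlam]
    exact ENNReal.mul_ne_top (by simp) (ENNReal.rpow_ne_top_of_nonneg ha.le (by simp))
  have h1 : 1 < lam := ENNReal.one_lt_two.trans_le hlam2
  have hp : 0 < r / (1 - r) := div_pos hr0 (by linarith)
  refine hD.lintegral_le _ fun F hF => ?_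
  set κ : ℤ → ℝ≥0∞ := fun m => mass (fun x => u x * mass w x (τ (m + 1)) ^ a) (τ (m - 1)) (τ m)
  let F' := F.map ⟨fun n : ℤ => n - 1, sub_left_injective⟩
  have hF' : ∀ n ∈ F', n ∈ N := by
    intro n hn
    obtain ⟨m, hm, rfl⟩ := Finset.mem_map.1 hn
    exact hD.down m (hF m hm) _ (by simp)
  refine le_trans ?_ (add_le_add
    (mul_le_mul_right
      (sum_tsum_supWeight_le hr0 hr1 ha hu hv hw hC hlam2 hlam' hD F hF κ fun _ => rfl) _)
    (mul_le_mul_right (sum_zpow_supWeight_le hr0 hr1 ha hu hv hw hC hlam2 hlam' hD F' hF') _))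
  rw [Finset.sum_map, Finset.mul_sum, Finset.mul_sum, ← Finset.sum_add_distrib]
  refine Finset.sum_le_sum fun n hn => ?_
  have hnN := hF n hn
  simp only [Function.Embedding.coeFn_mk]
  set p := r / (1 - r)
  set P := ∑' j : ℕ, κ (n - 1 - j)
  have hY : ∀ t, τ n ≤ t → mass (fun x => u x * mass w x t ^ a) 0 t ≤
      lam * P + 2 * (mass u 0 t * mass w (τ (n - 1)) t ^ a) := by
    intro t ht
    have key := mass_absorb hu hw ha.le (b := fun j => τ (n - j)) (t := t)
      (fun i j hij => hD.mono h1 hlam' (hD.down n hnN _ (by lia)) (by lia))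
      (fun j => hD.nonneg _) (fun x hx => hD.exists_lt h1 hlam' n hx)
      (fun j => by
        have := hD.mass_block_succ h1 hlam' (n := n - j - 2) (hD.down n hnN _ (by lia))
        rw [← hlam]
        push_cast
        rw [show n - ((j : ℤ) + 2) = n - j - 2 by ring, show n - ((j : ℤ) + 1) = n - j - 2 + 1 by ring,
          this, show n - (j : ℤ) - 2 + 1 + 1 = n - j by ring]) (by simpa using ht)
    rw [← hlam] at key
    have hP : P = ∑' j : ℕ, mass (fun x => u x * mass w x (τ (n - j)) ^ a) (τ (n - ((j + 2 : ℕ) : ℤ)))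
        (τ (n - ((j + 1 : ℕ) : ℤ))) := by
      refine tsum_congr fun j => ?_
      dsimp only [κ]
      push_cast
      rw [show n - 1 - (j : ℤ) + 1 = n - j by ring, show n - 1 - (j : ℤ) - 1 = n - (j + 2) by ring,
        show n - 1 - (j : ℤ) = n - (j + 1) by ring]
    rw [hP]
    simpa using key
  refine (lintegral_level_le hu.1 (2 ^ p * ((lam * P) ^ p * supWeight w v a p (τ n) +
    (2 * lam ^ (n + 1)) ^ p * supWeight w v (a * (p + 1)) p (τ (n - 1)))) n
    fun t _ h2 h3 => ?_).trans (le_of_eq ?_)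
  · have ht := (hD.lt_of_lt hnN h2).le
    rw [mul_comm _ (u t), mul_assoc]
    refine mul_le_mul_right ?_ _
    have hW : (mass w (τ (n - 1)) t ^ a) ^ p * supWeight w v a p t ≤
        supWeight w v (a * (p + 1)) p (τ (n - 1)) := by
      rw [supWeight, ENNReal.mul_iSup]
      refine iSup_le fun s => ?_
      rcases le_or_gt (s : ℝ) t with hs | hs
      · simp [mass_of_le hs, ENNReal.zero_rpow_of_pos ha]
      refine le_trans ?_ (le_iSup _ s)
      rw [← mul_assoc, mul_add, mul_one, ENNReal.rpow_add_of_nonneg _ _ (by positivity) ha.le,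
        ENNReal.rpow_mul]
      gcongr
      · exact mass_mono le_rfl hs.le
      · exact mass_mono ((hD.mono h1 hlam' hnN (by lia)).trans ht) le_rfl
    calc mass (fun x => u x * mass w x t ^ a) 0 t ^ p * supWeight w v a p t
        ≤ (lam * P + 2 * (mass u 0 t * mass w (τ (n - 1)) t ^ a)) ^ p * supWeight w v a p t := by
          gcongr
          exact hY t ht
      _ ≤ 2 ^ p * ((lam * P) ^ p + (2 * (mass u 0 t * mass w (τ (n - 1)) t ^ a)) ^ p) *
          supWeight w v a p t := by
          gcongr
          exact add_rpow_le_two _ _ hp.le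
      _ = 2 ^ p * ((lam * P) ^ p * supWeight w v a p t +
          (2 * mass u 0 t) ^ p * ((mass w (τ (n - 1)) t ^ a) ^ p * supWeight w v a p t)) := by
          rw [← mul_assoc 2, ENNReal.mul_rpow_of_nonneg _ (_ ^ a) hp.le]
          ring
      _ ≤ _ := by
          gcongr
          exact supWeight_anti w v ha.le p ht
  · have e1 : lam ^ (n + 1) = lam * lam ^ n := zpow_succ' h1 hlam' n
    have e2 : lam ^ (n + 1) = lam * lam * lam ^ (n - 1) := by
      rw [mul_assoc, ← zpow_succ' h1 hlam', sub_add_cancel, e1]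
    have e3 : lam ^ (n + 1) * (lam ^ (n + 1)) ^ p =
        (lam * lam) ^ (p + 1) * (lam ^ (n - 1)) ^ (p + 1) := by
      rw [← ENNReal.mul_rpow_of_nonneg _ _ (by positivity), ← e2,
        ENNReal.rpow_add_of_nonneg p 1 hp.le zero_le_one, ENNReal.rpow_one, mul_comm]
    rw [ENNReal.mul_rpow_of_nonneg _ _ hp.le, ENNReal.mul_rpow_of_nonneg _ _ hp.le]
    calc _ = 2 ^ p * lam ^ p * lam ^ (n + 1) * P ^ p * supWeight w v a p (τ n) +
          2 ^ p * 2 ^ p * (lam ^ (n + 1) * (lam ^ (n + 1)) ^ p) *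
            supWeight w v (a * (p + 1)) p (τ (n - 1)) := by ring
      _ = _ := by
          rw [e3, e1]
          ring

end necessity
theorem add_rpow_le_rpow_add {p x d : ℝ} (hp : 0 < p) (hx : 0 < x) (hd : 0 ≤ d) :
    (x + d) ^ p ≤ x ^ p + (p + 1) * (d * (x + d) ^ (p - 1)) := by
  have hX : 0 < x + d := by linarith
  have hz0 : 0 < x / (x + d) := div_pos hx hX
  have hz1 : x / (x + d) ≤ 1 := (div_le_one hX).2 (by linarith)
  have h1 := one_add_mul_self_le_rpow_one_add (s := x / (x + d) - 1) (by linarith)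
    (p := p + 1) (by linarith)
  rw [add_sub_cancel] at h1
  have h2 : (x / (x + d)) ^ (p + 1) ≤ (x / (x + d)) ^ p :=
    Real.rpow_le_rpow_of_exponent_ge hz0 hz1 (by linarith)
  have h3 := mul_le_mul_of_nonneg_right (h1.trans h2) (Real.rpow_nonneg hX.le p)
  rw [Real.div_rpow hx.le hX.le, div_mul_cancel₀ _ (Real.rpow_pos_of_pos hX p).ne'] at h3
  rw [Real.rpow_sub_one hX.ne']
  have h4 : (1 + (p + 1) * (x / (x + d) - 1)) * (x + d) ^ p =
      (x + d) ^ p - (p + 1) * (d * ((x + d) ^ p / (x + d))) := by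
    field_simp
    ring
  linarith

theorem add_sum_rpow_le {ι : Type*} [LinearOrder ι] {p D₀ : ℝ} (hp : 0 < p) (hD₀ : 0 < D₀)
    {d : ι → ℝ} (T : Finset ι) (hd : ∀ i ∈ T, 0 ≤ d i) :
    (D₀ + ∑ l ∈ T, d l) ^ p ≤
      D₀ ^ p + (p + 1) * ∑ l ∈ T, d l * (D₀ + ∑ k ∈ T with k ≤ l, d k) ^ (p - 1) := by
  induction T using Finset.induction_on_max with
  | empty => simp
  | insert m T hm ih =>
    have hmT : m ∉ T := fun h => lt_irrefl _ (hm m h)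
    have hT : ∀ i ∈ T, 0 ≤ d i := fun i hi => hd i (Finset.mem_insert_of_mem hi)
    have h1 : ∀ l ∈ T, ∑ k ∈ insert m T with k ≤ l, d k = ∑ k ∈ T with k ≤ l, d k := by
      intro l hl
      rw [Finset.filter_insert, if_neg (not_le.2 (hm l hl))]
    have h2 : ∑ k ∈ insert m T with k ≤ m, d k = ∑ k ∈ T, d k + d m := by
      rw [Finset.filter_true_of_mem, Finset.sum_insert hmT, add_comm]
      intro k hk
      rcases Finset.mem_insert.1 hk with rfl | hk
      · exact le_rfl
      · exact (hm k hk).le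
    have h5 : ∑ l ∈ T, d l * (D₀ + ∑ k ∈ insert m T with k ≤ l, d k) ^ (p - 1) =
        ∑ l ∈ T, d l * (D₀ + ∑ k ∈ T with k ≤ l, d k) ^ (p - 1) :=
      Finset.sum_congr rfl fun l hl => by rw [h1 l hl]
    rw [Finset.sum_insert hmT, Finset.sum_insert hmT, h2, h5]
    have h3 := add_rpow_le_rpow_add hp (x := D₀ + ∑ k ∈ T, d k) (d := d m)
      (add_pos_of_pos_of_nonneg hD₀ (Finset.sum_nonneg hT)) (hd m (Finset.mem_insert_self _ _))
    have h4 := ih hT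
    rw [show D₀ + (d m + ∑ k ∈ T, d k) = D₀ + ∑ k ∈ T, d k + d m by ring,
      show D₀ + (∑ k ∈ T, d k + d m) = D₀ + ∑ k ∈ T, d k + d m by ring]
    linarith

theorem exists_hardy_weights {ι : Type*} [LinearOrder ι] {p : ℝ} (hp : 0 < p) {d V : ι → ℝ}
    (S : Finset ι) (hd : ∀ i ∈ S, 0 < d i) (hV : ∀ i ∈ S, 0 < V i)
    (hVa : ∀ i ∈ S, ∀ j ∈ S, i ≤ j → V j ≤ V i) :
    ∃ F : ι → ℝ, (∀ i ∈ S, 0 < F i) ∧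
      (∀ j ∈ S, ∑ i ∈ S with i ≤ j, d i * F i ^ (-(1 / p)) ≤ (V j)⁻¹) ∧
      ∑ i ∈ S, d i * F i ≤ (p + 2) * ∑ i ∈ S, (∑ j ∈ S with j ≤ i, d j) ^ p * d i * V i ^ p := by
  set D : ι → ℝ := fun i => ∑ j ∈ S with j ≤ i, d j
  have hD : ∀ i ∈ S, 0 < D i := fun i hi =>
    Finset.sum_pos (fun j hj => hd j (Finset.mem_filter.1 hj).1)
      ⟨i, Finset.mem_filter.2 ⟨hi, le_rfl⟩⟩
  have hnn : ∀ l ∈ S, 0 ≤ d l * D l ^ (p - 1) * V l ^ p := fun l hl =>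
    mul_nonneg (mul_nonneg (hd l hl).le (Real.rpow_nonneg (hD l hl).le _))
      (Real.rpow_nonneg (hV l hl).le _)
  set F : ι → ℝ := fun i =>
    D i ^ p * V i ^ p + (p + 1) * ∑ l ∈ S with i < l, d l * D l ^ (p - 1) * V l ^ p
  have hF0 : ∀ i ∈ S, 0 < F i := fun i hi =>
    add_pos_of_pos_of_nonneg
      (mul_pos (Real.rpow_pos_of_pos (hD i hi) _) (Real.rpow_pos_of_pos (hV i hi) _))
      (mul_nonneg (by linarith)
        (Finset.sum_nonneg fun l hl => hnn l (Finset.mem_filter.1 hl).1))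
  have hF : ∀ i ∈ S, ∀ j ∈ S, i ≤ j → (D j * V j) ^ p ≤ F i := by
    intro i hi j hj hij
    set T := S.filter fun l => i < l ∧ l ≤ j
    have hTS : ∀ l ∈ T, l ∈ S ∧ i < l ∧ l ≤ j := fun l hl => Finset.mem_filter.1 hl
    have hDl : ∀ l ∈ S, i ≤ l → l ≤ j → D l = D i + ∑ k ∈ T with k ≤ l, d k := by
      intro l _ hil hlj
      dsimp only [D, T]
      rw [Finset.filter_filter, ← Finset.sum_union]
      · congr 1
        ext k
        simp only [Finset.mem_filter, Finset.mem_union]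
        constructor
        · rintro ⟨hk, hkl⟩
          rcases le_or_gt k i with h | h
          · exact Or.inl ⟨hk, h⟩
          · exact Or.inr ⟨hk, ⟨h, hkl.trans hlj⟩, hkl⟩
        · rintro (⟨hk, h⟩ | ⟨hk, _, h⟩)
          · exact ⟨hk, h.trans hil⟩
          · exact ⟨hk, h⟩
      · refine Finset.disjoint_left.2 fun k hk hk' => ?_
        exact absurd (Finset.mem_filter.1 hk).2 (not_le.2 (Finset.mem_filter.1 hk').2.1.1)
    have key := add_sum_rpow_le hp (hD i hi) T fun l hl => (hd l (hTS l hl).1).le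
    have hT : ∑ l ∈ T, d l * (D i + ∑ k ∈ T with k ≤ l, d k) ^ (p - 1) =
        ∑ l ∈ T, d l * D l ^ (p - 1) :=
      Finset.sum_congr rfl fun l hl => by
        rw [hDl l (hTS l hl).1 (hTS l hl).2.1.le (hTS l hl).2.2]
    rw [hT] at key
    have hDj : D j = D i + ∑ k ∈ T, d k := by
      rw [hDl j hj hij le_rfl, Finset.filter_true_of_mem fun k hk => (hTS k hk).2.2]
    rw [← hDj] at key
    have hVj := Real.rpow_nonneg (hV j hj).le p
    rw [Real.mul_rpow (hD j hj).le (hV j hj).le]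
    refine (mul_le_mul_of_nonneg_right key hVj).trans ?_
    rw [add_mul, mul_assoc, Finset.sum_mul]
    refine add_le_add ?_ (mul_le_mul_of_nonneg_left ?_ (by linarith))
    · exact mul_le_mul_of_nonneg_left
        (Real.rpow_le_rpow (hV j hj).le (hVa i hi j hj hij) hp.le) (Real.rpow_nonneg (hD i hi).le _)
    · refine (Finset.sum_le_sum fun l hl => ?_).trans (Finset.sum_le_sum_of_subset_of_nonneg
        (s := T) (fun l hl => Finset.mem_filter.2 ⟨(hTS l hl).1, (hTS l hl).2.1⟩)
        fun l hl _ => hnn l (Finset.mem_filter.1 hl).1)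
      obtain ⟨hl, _, hlj⟩ := hTS l hl
      exact mul_le_mul_of_nonneg_left
        (Real.rpow_le_rpow (hV j hj).le (hVa l hl j hj hlj) hp.le)
        (mul_nonneg (hd l hl).le (Real.rpow_nonneg (hD l hl).le _))
  refine ⟨F, hF0, ?_, ?_⟩
  · intro j hj
    have hDV : 0 < D j * V j := mul_pos (hD j hj) (hV j hj)
    calc ∑ i ∈ S with i ≤ j, d i * F i ^ (-(1 / p))
        ≤ ∑ i ∈ S with i ≤ j, d i * (D j * V j)⁻¹ := by
          refine Finset.sum_le_sum fun i hi => ?_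
          obtain ⟨hi, hij⟩ := Finset.mem_filter.1 hi
          refine mul_le_mul_of_nonneg_left ?_ (hd i hi).le
          have e : (D j * V j)⁻¹ = ((D j * V j) ^ p) ^ (-(1 / p)) := by
            rw [← Real.rpow_mul hDV.le, mul_neg, mul_one_div_cancel hp.ne', Real.rpow_neg_one]
          rw [e]
          exact Real.rpow_le_rpow_of_nonpos (Real.rpow_pos_of_pos hDV p) (hF i hi j hj hij)
            (by simp [hp.le])
      _ = (V j)⁻¹ := by
          rw [← Finset.sum_mul]
          change D j * _ = _
          have := (hD j hj).ne'
          field_simp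
  · have hsum : ∑ i ∈ S, d i * ∑ l ∈ S with i < l, d l * D l ^ (p - 1) * V l ^ p ≤
        ∑ l ∈ S, D l ^ p * d l * V l ^ p := by
      simp_rw [Finset.mul_sum, Finset.sum_filter]
      rw [Finset.sum_comm]
      refine Finset.sum_le_sum fun l hl => ?_
      calc ∑ i ∈ S, (if i < l then d i * (d l * D l ^ (p - 1) * V l ^ p) else 0)
          ≤ ∑ i ∈ S, (if i ≤ l then d i * (d l * D l ^ (p - 1) * V l ^ p) else 0) := by
            refine Finset.sum_le_sum fun i hi => ?_
            split_ifs with h1 h2 h2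
            · exact le_rfl
            · exact absurd h1.le h2
            · exact mul_nonneg (hd i hi).le (hnn l hl)
            · exact le_rfl
        _ = D l * (d l * D l ^ (p - 1) * V l ^ p) := by
            rw [← Finset.sum_filter, ← Finset.sum_mul]
        _ = _ := by
            have := (hD l hl).ne'
            rw [Real.rpow_sub_one this]
            field_simp
    calc ∑ i ∈ S, d i * F i
        = ∑ i ∈ S, D i ^ p * d i * V i ^ p +
          (p + 1) * ∑ i ∈ S, d i * ∑ l ∈ S with i < l, d l * D l ^ (p - 1) * V l ^ p := by
          rw [Finset.mul_sum, ← Finset.sum_add_distrib]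
          exact Finset.sum_congr rfl fun i _ => by simp only [F]; ring
      _ ≤ _ := by
          have := mul_le_mul_of_nonneg_left hsum (show 0 ≤ p + 1 by linarith)
          linarith

theorem sum_mul_tail_le {v h : ℝ → ℝ≥0∞} (hh : Measurable h) (S : Finset ℚ)
    (hS : ∀ i ∈ S, 0 < i) {x : ℚ → ℝ≥0∞}
    (hx : ∀ j ∈ S, ∑ i ∈ S with i ≤ j, x i ≤ (tailSup v j)⁻¹) :
    ∑ i ∈ S, x i * tail h i ≤ ∫⁻ y in Ioi 0, h y * v y := by
  have h1 : ∀ i ∈ S, x i * tail h i =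
      ∫⁻ y in Ioi (0 : ℝ), h y * (Ioi (i : ℝ)).indicator (fun _ => x i) y := by
    intro i hi
    have : Ioi (i : ℝ) ∩ Ioi 0 = Ioi (i : ℝ) :=
      inter_eq_left.2 (Ioi_subset_Ioi (by exact_mod_cast (hS i hi).le))
    simp_rw [← indicator_mul_right]
    rw [lintegral_indicator measurableSet_Ioi, Measure.restrict_restrict measurableSet_Ioi, this,
      lintegral_mul_const _ hh, mul_comm]
    rfl
  rw [Finset.sum_congr rfl h1, ← lintegral_finsetSum]
  swap
  · exact fun i _ => hh.mul (measurable_const.indicator measurableSet_Ioi)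
  have key : ∀ᵐ y : ℝ, ∀ s : ℚ, (s : ℝ) < y → (v y)⁻¹ ≤ tailSup v s := by
    rw [ae_all_iff]
    intro s
    exact (ae_restrict_iff' measurableSet_Ioi).1
      (ENNReal.ae_le_essSup (μ := volume.restrict (Ioi (s : ℝ))) fun y => (v y)⁻¹)
  refine lintegral_mono_ae ?_
  filter_upwards [ae_restrict_of_ae key] with y hy
  rw [← Finset.mul_sum]
  gcongr
  simp_rw [indicator_apply, mem_Ioi]
  rw [← Finset.sum_filter]
  rcases (S.filter fun i : ℚ => (i : ℝ) < y).eq_empty_or_nonempty with h0 | h0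
  · simp [h0]
  · have hj := Finset.max'_mem _ h0
    set j := Finset.max' _ h0
    obtain ⟨hjS, hjy⟩ := Finset.mem_filter.1 hj
    refine (Finset.sum_le_sum_of_subset ?_).trans ((hx j hjS).trans
      (ENNReal.inv_le_iff_inv_le.1 (hy j hjy)))
    exact fun i hi => Finset.mem_filter.2 ⟨(Finset.mem_filter.1 hi).1, Finset.le_max' _ _ hi⟩

theorem sum_mul_tail_rpow_le_of_pos {r : ℝ} (hr0 : 0 < r) (hr1 : r < 1) {v h : ℝ → ℝ≥0∞}
    (hv : IsWeight v) (hh : Measurable h) (S : Finset ℚ) (hS : ∀ i ∈ S, 0 < i)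
    (hV : ∀ i ∈ S, tailSup v i ≠ ∞) {d : ℚ → ℝ≥0∞} (hd : ∀ i ∈ S, d i ≠ ∞)
    (hd0 : ∀ i ∈ S, d i ≠ 0) :
    ∑ i ∈ S, d i * tail h i ^ r ≤
      (ENNReal.ofReal (r / (1 - r) + 2) * ∑ i ∈ S, (∑ j ∈ S with j ≤ i, d j) ^ (r / (1 - r)) * d i *
        tailSup v i ^ (r / (1 - r))) ^ (1 - r) * (∫⁻ y in Ioi 0, h y * v y) ^ r := by
  set p := r / (1 - r) with hpdef
  have h1r : 0 < 1 - r := by linarith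
  have hp : 0 < p := div_pos hr0 h1r
  have hdr : ∀ i ∈ S, 0 < (d i).toReal := fun i hi => ENNReal.toReal_pos (hd0 i hi) (hd i hi)
  have hVr : ∀ i ∈ S, 0 < (tailSup v i).toReal := fun i hi =>
    ENNReal.toReal_pos (tailSup_pos hv i).ne' (hV i hi)
  obtain ⟨F, hF, hFV, hFs⟩ := exists_hardy_weights hp (d := fun i => (d i).toReal)
    (V := fun i : ℚ => (tailSup v i).toReal) S hdr hVr fun i hi j _ hij =>
      ENNReal.toReal_mono (hV i hi) (tailSup_anti v (by exact_mod_cast hij))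
  set x : ℚ → ℝ≥0∞ := fun i => ENNReal.ofReal ((d i).toReal * F i ^ (-(1 / p)))
  have hx0 : ∀ i ∈ S, 0 < (d i).toReal * F i ^ (-(1 / p)) := fun i hi =>
    mul_pos (hdr i hi) (Real.rpow_pos_of_pos (hF i hi) _)
  have hdF0 : ∀ i ∈ S, 0 < (d i).toReal * F i := fun i hi => mul_pos (hdr i hi) (hF i hi)
  have hx : ∀ j ∈ S, ∑ i ∈ S with i ≤ j, x i ≤ (tailSup v j)⁻¹ := by
    intro j hj
    rw [← ENNReal.ofReal_sum_of_nonneg fun i hi => (hx0 i (Finset.mem_filter.1 hi).1).le]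
    refine (ENNReal.ofReal_le_ofReal (hFV j hj)).trans ?_
    rw [ENNReal.ofReal_inv_of_pos (hVr j hj), ENNReal.ofReal_toReal (hV j hj)]
  have hdF : ∑ i ∈ S, ENNReal.ofReal ((d i).toReal * F i) ≤
      ENNReal.ofReal (p + 2) * ∑ i ∈ S, (∑ j ∈ S with j ≤ i, d j) ^ p * d i *
        tailSup v i ^ p := by
    rw [← ENNReal.ofReal_sum_of_nonneg fun i hi => (hdF0 i hi).le]
    refine (ENNReal.ofReal_le_ofReal hFs).trans ?_
    have hDn : ∀ i : ℚ, 0 ≤ ∑ j ∈ S with j ≤ i, (d j).toReal := fun i =>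
      Finset.sum_nonneg fun j _ => ENNReal.toReal_nonneg
    rw [ENNReal.ofReal_mul (by linarith), ENNReal.ofReal_sum_of_nonneg fun i _ =>
      mul_nonneg (mul_nonneg (Real.rpow_nonneg (hDn i) _) ENNReal.toReal_nonneg)
        (Real.rpow_nonneg ENNReal.toReal_nonneg _)]
    refine mul_le_mul_right (Finset.sum_le_sum fun i hi => le_of_eq ?_) _
    rw [ENNReal.ofReal_mul (mul_nonneg (Real.rpow_nonneg (hDn i) _) ENNReal.toReal_nonneg),
      ENNReal.ofReal_mul (Real.rpow_nonneg (hDn i) _),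
      ← ENNReal.ofReal_rpow_of_nonneg (hDn i) hp.le,
      ← ENNReal.ofReal_rpow_of_nonneg ENNReal.toReal_nonneg hp.le,
      ENNReal.ofReal_toReal (hd i hi), ENNReal.ofReal_toReal (hV i hi),
      ENNReal.ofReal_sum_of_nonneg fun j _ => ENNReal.toReal_nonneg]
    congr 3
    exact Finset.sum_congr rfl fun j hj => ENNReal.ofReal_toReal (hd j (Finset.mem_filter.1 hj).1)
  have hsplit : ∀ i ∈ S, d i * tail h i ^ r =
      ENNReal.ofReal ((d i).toReal * F i) ^ (1 - r) * (x i * tail h i) ^ r := by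
    intro i hi
    rw [ENNReal.mul_rpow_of_nonneg _ _ hr0.le, ← mul_assoc]
    congr 1
    rw [ENNReal.ofReal_rpow_of_pos (hdF0 i hi), ENNReal.ofReal_rpow_of_pos (hx0 i hi),
      ← ENNReal.ofReal_mul (Real.rpow_nonneg (hdF0 i hi).le _)]
    rw [← ENNReal.ofReal_toReal (hd i hi)]
    congr 1
    rw [ENNReal.ofReal_toReal (hd i hi), Real.mul_rpow (hdr i hi).le (hF i hi).le,
      Real.mul_rpow (hdr i hi).le (Real.rpow_nonneg (hF i hi).le _),
      ← Real.rpow_mul (hF i hi).le]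
    have e : -(1 / p) * r = -(1 - r) := by
      rw [hpdef]
      field_simp
    have e1 : (d i).toReal ^ (1 - r) * (d i).toReal ^ r = (d i).toReal := by
      rw [← Real.rpow_add (hdr i hi), sub_add_cancel, Real.rpow_one]
    have e2 : F i ^ (1 - r) * F i ^ (-(1 - r)) = 1 := by
      rw [← Real.rpow_add (hF i hi), add_neg_cancel, Real.rpow_zero]
    rw [e, mul_mul_mul_comm, e1, e2, mul_one]
  rw [Finset.sum_congr rfl hsplit]
  have hpq : (1 / (1 - r)).HolderConjugate (1 / r) := by
    rw [Real.holderConjugate_iff]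
    refine ⟨(one_lt_div h1r).2 (by linarith), by simp⟩
  refine (ENNReal.inner_le_Lp_mul_Lq S _ _ hpq).trans ?_
  have c1 : ∀ y : ℝ≥0∞, (y ^ (1 - r)) ^ (1 / (1 - r)) = y := fun y => by
    rw [← ENNReal.rpow_mul, mul_one_div_cancel h1r.ne', ENNReal.rpow_one]
  have c2 : ∀ y : ℝ≥0∞, (y ^ r) ^ (1 / r) = y := fun y => by
    rw [← ENNReal.rpow_mul, mul_one_div_cancel hr0.ne', ENNReal.rpow_one]
  simp_rw [c1, c2, one_div_one_div]
  exact mul_le_mul' (ENNReal.rpow_le_rpow hdF h1r.le)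
    (ENNReal.rpow_le_rpow (sum_mul_tail_le hh S hS hx) hr0.le)

theorem sum_mul_tail_rpow_le {r : ℝ} (hr0 : 0 < r) (hr1 : r < 1) {v h : ℝ → ℝ≥0∞}
    (hv : IsWeight v) (hh : Measurable h) (S : Finset ℚ) (hS : ∀ i ∈ S, 0 < i)
    (hV : ∀ i ∈ S, tailSup v i ≠ ∞) {d : ℚ → ℝ≥0∞} (hd : ∀ i ∈ S, d i ≠ ∞) :
    ∑ i ∈ S, d i * tail h i ^ r ≤
      (ENNReal.ofReal (r / (1 - r) + 2) * ∑ i ∈ S, (∑ j ∈ S with j ≤ i, d j) ^ (r / (1 - r)) * d i *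
        tailSup v i ^ (r / (1 - r))) ^ (1 - r) * (∫⁻ y in Ioi 0, h y * v y) ^ r := by
  classical
  have h1r : 0 < 1 - r := by linarith
  have hp : 0 ≤ r / (1 - r) := (div_pos hr0 h1r).le
  set T := S.filter fun i => d i ≠ 0
  have hT : T ⊆ S := Finset.filter_subset _ _
  have h1 : ∑ i ∈ S, d i * tail h i ^ r = ∑ i ∈ T, d i * tail h i ^ r := by
    refine (Finset.sum_subset hT fun i hi hiT => ?_).symm
    have : d i = 0 := by
      by_contra h0
      exact hiT (Finset.mem_filter.2 ⟨hi, h0⟩)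
    rw [this, zero_mul]
  rw [h1]
  refine (sum_mul_tail_rpow_le_of_pos hr0 hr1 hv hh T (fun i hi => hS i (hT hi))
    (fun i hi => hV i (hT hi)) (fun i hi => hd i (hT hi))
    fun i hi => (Finset.mem_filter.1 hi).2).trans ?_
  gcongr ?_ * _
  refine ENNReal.rpow_le_rpow (mul_le_mul_right ?_ _) h1r.le
  refine (Finset.sum_le_sum fun i _ => ?_).trans (Finset.sum_le_sum_of_subset hT)
  gcongr

theorem rpow_mul_lintegral_le {g Z : ℝ → ℝ≥0∞} (hg : Measurable g) {A : Set ℝ}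
    (hA : MeasurableSet A) (hA0 : A ⊆ Ioi 0) (hc : ∫⁻ t in A, g t ≠ ∞) {p : ℝ} (hp : 0 ≤ p)
    {D : ℝ≥0∞} (hZ : ∀ t ∈ A, D + mass (A.indicator g) 0 t ≤ Z t) :
    (D + ∫⁻ t in A, g t) ^ p * ∫⁻ t in A, g t ≤ 2 ^ (p + 1) * ∫⁻ t in A, Z t ^ p * g t := by
  set c := ∫⁻ t in A, g t
  set B := {t : ℝ | 0 < t ∧ mass (A.indicator g) 0 t ≤ c / 2}
  have hB : MeasurableSet B :=
    measurableSet_Ioi.inter (measurable_mass_right _ 0 measurableSet_Iic)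
  have h1 : ∫⁻ t in A ∩ B, g t ≤ c / 2 := by
    have := lintegral_mass_sublevel_le (A.indicator g) (c / 2)
    rwa [setLIntegral_indicator hA] at this
  have h2 : c / 2 ≤ ∫⁻ t in A \ B, g t := by
    have h3 : c / 2 + c / 2 ≤ c / 2 + ∫⁻ t in A \ B, g t := by
      rw [ENNReal.add_halves]
      calc c = (∫⁻ t in A ∩ B, g t) + ∫⁻ t in A \ B, g t := (lintegral_inter_add_sdiff g A hB).symm
        _ ≤ _ := add_le_add_left h1 _
    exact (ENNReal.add_le_add_iff_left (ENNReal.div_ne_top hc two_ne_zero)).1 h3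
  have h4 : ((D + c) / 2) ^ p * (c / 2) ≤ ∫⁻ t in A, Z t ^ p * g t := by
    calc ((D + c) / 2) ^ p * (c / 2) ≤ ((D + c) / 2) ^ p * ∫⁻ t in A \ B, g t := by gcongr
      _ = ∫⁻ t in A \ B, ((D + c) / 2) ^ p * g t := (lintegral_const_mul _ hg).symm
      _ ≤ ∫⁻ t in A \ B, Z t ^ p * g t := by
          refine setLIntegral_mono' (hA.diff hB) fun t ht => ?_
          gcongr
          refine le_trans ?_ (hZ t ht.1)
          have h5 : c / 2 ≤ mass (A.indicator g) 0 t := by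
            by_contra h
            exact ht.2 ⟨hA0 ht.1, (not_le.1 h).le⟩
          rw [ENNReal.add_div]
          exact add_le_add ENNReal.half_le_self h5
      _ ≤ _ := lintegral_mono_set sdiff_subset
  calc (D + c) ^ p * c = (2 * ((D + c) / 2)) ^ p * (2 * (c / 2)) := by
        rw [ENNReal.mul_div_cancel two_ne_zero ENNReal.ofNat_ne_top,
          ENNReal.mul_div_cancel two_ne_zero ENNReal.ofNat_ne_top]
    _ = 2 ^ (p + 1) * (((D + c) / 2) ^ p * (c / 2)) := by
        rw [ENNReal.mul_rpow_of_nonneg _ _ hp,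
          ENNReal.rpow_add _ _ two_ne_zero ENNReal.ofNat_ne_top, ENNReal.rpow_one]
        ring
    _ ≤ _ := by gcongr

/-- The positive points at which `f i` is positive and `i` is the first index of `S` attaining
the maximum of `f`. -/
def firstMax (f : ℚ → ℝ → ℝ≥0∞) (S : Finset ℚ) (i : ℚ) : Set ℝ :=
  {t | 0 < t ∧ 0 < f i t ∧ ∀ j ∈ S, f j t ≤ f i t ∧ (j < i → f j t < f i t)}

theorem measurableSet_firstMax {f : ℚ → ℝ → ℝ≥0∞} (hf : ∀ i, Measurable (f i)) (S : Finset ℚ)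
    (i : ℚ) : MeasurableSet (firstMax f S i) := by
  refine measurableSet_Ioi.inter ((measurableSet_lt measurable_const (hf i)).inter ?_)
  have : {t | ∀ j ∈ S, f j t ≤ f i t ∧ (j < i → f j t < f i t)} =
      ⋂ j ∈ S, {t | f j t ≤ f i t} ∩ {t | j < i → f j t < f i t} := by
    ext t
    simp
  change MeasurableSet {t | ∀ j ∈ S, f j t ≤ f i t ∧ (j < i → f j t < f i t)}
  rw [this]
  refine S.measurableSet_biInter fun j _ => (measurableSet_le (hf j) (hf i)).inter ?_
  by_cases h : j < i
  · simpa [h] using measurableSet_lt (hf j) (hf i)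
  · simp [h]

theorem pairwiseDisjoint_firstMax (f : ℚ → ℝ → ℝ≥0∞) (S : Finset ℚ) :
    (S : Set ℚ).PairwiseDisjoint (firstMax f S) := by
  intro i hi j hj hij
  refine Set.disjoint_left.2 fun t ht ht' => ?_
  rcases lt_or_gt_of_ne hij with h | h
  · exact absurd (ht.2.2 j hj).1 (not_le.2 ((ht'.2.2 i hi).2 h))
  · exact absurd (ht'.2.2 i hi).1 (not_le.2 ((ht.2.2 j hj).2 h))

theorem exists_mem_firstMax {f : ℚ → ℝ → ℝ≥0∞} {S : Finset ℚ} {t : ℝ} (ht : 0 < t) {j : ℚ}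
    (hj : j ∈ S) (hfj : 0 < f j t) : ∃ i ∈ S, t ∈ firstMax f S i := by
  obtain ⟨m, hm, hmax⟩ := S.exists_max_image (fun i => f i t) ⟨j, hj⟩
  have hne : (S.filter fun i => f i t = f m t).Nonempty := ⟨m, Finset.mem_filter.2 ⟨hm, rfl⟩⟩
  have hi := Finset.min'_mem _ hne
  have hmin := fun k hk => Finset.min'_le (S.filter fun i => f i t = f m t) k hk
  set i := Finset.min' _ hne
  obtain ⟨hiS, hfi⟩ := Finset.mem_filter.1 hi
  refine ⟨i, hiS, ht, ?_, fun k hk => ⟨hfi ▸ hmax k hk, fun hki => ?_⟩⟩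
  · rw [hfi]
    exact hfj.trans_le (hmax j hj)
  · rw [hfi]
    refine lt_of_le_of_ne (hmax k hk) fun h => ?_
    exact absurd (hmin k (Finset.mem_filter.2 ⟨hk, h⟩)) (not_le.2 hki)

theorem setLIntegral_mul_iSup_le {f : ℚ → ℝ → ℝ≥0∞} (S : Finset ℚ)
    {u : ℝ → ℝ≥0∞} (hu : Measurable u) (hf : ∀ i, Measurable (f i)) {a : ℝ} (ha : 0 < a) :
    ∫⁻ t in Ioi 0, u t * ⨆ i ∈ S, f i t ^ a ≤
      ∑ i ∈ S, ∫⁻ t in firstMax f S i, u t * f i t ^ a := by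
  calc ∫⁻ t in Ioi 0, u t * ⨆ i ∈ S, f i t ^ a
      ≤ ∫⁻ t, ∑ i ∈ S, (firstMax f S i).indicator (fun t => u t * f i t ^ a) t := by
        rw [← lintegral_indicator measurableSet_Ioi]
        refine lintegral_mono fun t => ?_
        by_cases ht : 0 < t
        · rw [indicator_of_mem (mem_Ioi.2 ht)]
          by_cases h : ∃ j ∈ S, 0 < f j t
          · obtain ⟨j, hj, hfj⟩ := h
            obtain ⟨i, hi, hti⟩ := exists_mem_firstMax ht hj hfj
            refine le_trans ?_ (Finset.single_le_sum (fun _ _ => zero_le) hi)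
            rw [indicator_of_mem hti]
            gcongr
            exact iSup₂_le fun k hk => ENNReal.rpow_le_rpow (hti.2.2 k hk).1 ha.le
          · push Not at h
            have : ⨆ i ∈ S, f i t ^ a = 0 := by
              refine le_antisymm (iSup₂_le fun k hk => ?_) (zero_le)
              rw [nonpos_iff_eq_zero.1 (h k hk), ENNReal.zero_rpow_of_pos ha]
            rw [this, mul_zero]
            exact zero_le
        · rw [indicator_of_notMem (by simpa using ht)]
          exact zero_le
    _ = _ := by
        rw [lintegral_finsetSum]
        · exact Finset.sum_congr rfl fun i _ =>
            lintegral_indicator (measurableSet_firstMax hf S i) _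
        · exact fun i _ => (hu.mul ((hf i).pow_const a)).indicator (measurableSet_firstMax hf S i)

theorem le_of_mem_firstMax {w : ℝ → ℝ≥0∞} {P : ℚ → ℝ≥0∞} (hP : Antitone P) {S : Finset ℚ}
    {i j : ℚ} (hi : i ∈ S) (hj : j ∈ S) {x t : ℝ} (hxt : x < t)
    (hx : x ∈ firstMax (fun i t => mass w t i * P i) S j)
    (ht : t ∈ firstMax (fun i t => mass w t i * P i) S i) : j ≤ i := by
  by_contra! hij
  have h1 := (hx.2.2 i hi).2 hij
  have h2 := (ht.2.2 j hj).1
  have hti : t ≤ i := by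
    by_contra! h
    have := ht.2.1
    simp [mass_of_le h.le] at this
  have htj : t ≤ j := hti.trans (by exact_mod_cast hij.le)
  simp only at h1 h2
  rw [← mass_add w hxt.le hti, ← mass_add w hxt.le htj, add_mul, add_mul] at h1
  exact absurd h1 (not_lt.2 (add_le_add (mul_le_mul_right (hP hij.le) _) h2))

theorem firstMax_subset {w : ℝ → ℝ≥0∞} {P : ℚ → ℝ≥0∞} {S : Finset ℚ} (i : ℚ) :
    firstMax (fun i t => mass w t i * P i) S i ⊆ Ioc 0 (i : ℝ) := by
  refine fun t ht => ⟨ht.1, ?_⟩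
  by_contra! h
  have := ht.2.1
  simp [mass_of_le h.le] at this

theorem sum_add_mass_le {u w : ℝ → ℝ≥0∞} {a : ℝ} (ha : 0 < a)
    {P : ℚ → ℝ≥0∞} (hP : Antitone P) {S : Finset ℚ} {i : ℚ} (hi : i ∈ S) {t : ℝ}
    (ht : t ∈ firstMax (fun i t => mass w t i * P i) S i) :
    ∑ j ∈ S with j < i, (∫⁻ x in firstMax (fun i t => mass w t i * P i) S j,
        u x * mass w x j ^ a) +
      mass ((firstMax (fun i t => mass w t i * P i) S i).indicator
        fun x => u x * mass w x i ^ a) 0 t ≤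
      mass (fun x => u x * mass w x i ^ a) 0 t := by
  set A := firstMax (fun i t => mass w t i * P i) S
  have hA : ∀ i, MeasurableSet (A i) := measurableSet_firstMax
    (fun i => (measurable_mass_left w i).mul_const _) S
  have hdisj := pairwiseDisjoint_firstMax (fun i t => mass w t i * P i) S
  have hsub : ∀ j ∈ S.filter (· < i), A j ⊆ Ioc 0 t := fun j hj x hx => by
    refine ⟨hx.1, ?_⟩
    by_contra! h
    exact absurd (le_of_mem_firstMax hP (Finset.mem_filter.1 hj).1 hi h ht hx)
      (not_le.2 (Finset.mem_filter.1 hj).2)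
  set U := ⋃ j ∈ S.filter (· < i), A j
  have hd2 : Disjoint U (A i ∩ Ioc 0 t) := by
    refine Set.disjoint_left.2 fun x hx hx' => ?_
    simp only [U, mem_iUnion, exists_prop] at hx
    obtain ⟨j, hj, hxj⟩ := hx
    exact Set.disjoint_left.1 (hdisj (Finset.mem_filter.1 hj).1 hi (Finset.mem_filter.1 hj).2.ne)
      hxj hx'.1
  unfold mass
  rw [setLIntegral_indicator (hA i)]
  change _ + ∫⁻ x in A i ∩ Ioc 0 t, u x * mass w x i ^ a ≤ ∫⁻ x in Ioc 0 t, u x * mass w x i ^ a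
  calc _ ≤ (∫⁻ x in U, u x * mass w x i ^ a) +
        ∫⁻ x in A i ∩ Ioc 0 t, u x * mass w x i ^ a := by
        gcongr
        rw [lintegral_biUnion_finset (hdisj.subset fun j hj => (Finset.mem_filter.1 hj).1)
          fun j _ => hA j]
        refine Finset.sum_le_sum fun j hj => lintegral_mono fun x => ?_
        gcongr
        exact mass_mono le_rfl (by exact_mod_cast (Finset.mem_filter.1 hj).2.le)
    _ = ∫⁻ x in U ∪ A i ∩ Ioc 0 t, u x * mass w x i ^ a :=
        (lintegral_union ((hA i).inter measurableSet_Ioc) hd2).symm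
    _ ≤ _ := by
        refine lintegral_mono_set (union_subset ?_ inter_subset_right)
        simp only [U, iUnion_subset_iff]
        exact hsub

theorem mass_mul_rpow_le {u w : ℝ → ℝ≥0∞} (hu : Measurable u) {a p : ℝ} (ha : 0 < a) (hp : 0 < p)
    (s t : ℝ) :
    mass (fun x => u x * mass w x s ^ a) 0 t ^ p ≤
      2 ^ (a * p + p) * (mass (fun x => u x * mass w x t ^ a) 0 t ^ p +
        mass u 0 t ^ p * mass w t s ^ (a * p)) := by
  have h1 : mass (fun x => u x * mass w x s ^ a) 0 t ≤
      2 ^ a * (mass (fun x => u x * mass w x t ^ a) 0 t + mass u 0 t * mass w t s ^ a) := by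
    have hm : Measurable fun x => u x * mass w x t ^ a :=
      hu.mul ((measurable_mass_left w t).pow_const a)
    change ∫⁻ x in Ioc 0 t, u x * mass w x s ^ a ≤ 2 ^ a *
      ((∫⁻ x in Ioc 0 t, u x * mass w x t ^ a) + (∫⁻ x in Ioc 0 t, u x) * mass w t s ^ a)
    rw [← lintegral_mul_const _ hu, ← lintegral_add_left hm, ← lintegral_const_mul]
    · refine lintegral_mono fun x => ?_
      calc u x * mass w x s ^ a ≤ u x * (2 ^ a * (mass w x t ^ a + mass w t s ^ a)) := by
            gcongr
            exact (ENNReal.rpow_le_rpow (mass_le_add w x t s) ha.le).trans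
              (add_rpow_le_two _ _ ha.le)
        _ = 2 ^ a * (u x * mass w x t ^ a + u x * mass w t s ^ a) := by ring
    · exact hm.add (hu.mul_const _)
  calc _ ≤ (2 ^ a * (mass (fun x => u x * mass w x t ^ a) 0 t + mass u 0 t * mass w t s ^ a)) ^ p :=
        ENNReal.rpow_le_rpow h1 hp.le
    _ ≤ (2 ^ a) ^ p * (2 ^ p * (mass (fun x => u x * mass w x t ^ a) 0 t ^ p +
        (mass u 0 t * mass w t s ^ a) ^ p)) := by
        rw [ENNReal.mul_rpow_of_nonneg _ _ hp.le]
        gcongr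
        exact add_rpow_le_two _ _ hp.le
    _ = _ := by
        rw [ENNReal.mul_rpow_of_nonneg _ _ hp.le, ← ENNReal.rpow_mul, ← ENNReal.rpow_mul,
          ENNReal.rpow_add _ _ two_ne_zero ENNReal.ofNat_ne_top]
        ring

theorem sum_block_mul_tailSup_le {u v w : ℝ → ℝ≥0∞} (hu : IsWeight u)
    {a p : ℝ} (ha : 0 < a) (hp : 0 < p) {P : ℚ → ℝ≥0∞} (hP : Antitone P) (S : Finset ℚ)
    {d : ℚ → ℝ≥0∞} (hd : ∀ i, d i = ∫⁻ x in firstMax (fun i t => mass w t i * P i) S i,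
      u x * mass w x i ^ a) (hdt : ∀ i, d i ≠ ∞) :
    ∑ i ∈ S, (∑ j ∈ S with j ≤ i, d j) ^ p * d i * tailSup v i ^ p ≤
      2 ^ (p + 1) * (2 ^ (a * p + p) *
        ((∫⁻ t in Ioi 0, mass u 0 t ^ p * u t * supWeight w v (a * (p + 1)) p t) +
        ∫⁻ t in Ioi 0, mass (fun x => u x * mass w x t ^ a) 0 t ^ p * u t *
          supWeight w v a p t)) := by
  set A := firstMax (fun i t => mass w t i * P i) S
  have hA : ∀ i, MeasurableSet (A i) := measurableSet_firstMax
    (fun i => (measurable_mass_left w i).mul_const _) S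
  have hAsub : ∀ i, A i ⊆ Ioi 0 := fun i t ht => ht.1
  set Φ : ℝ → ℝ≥0∞ := fun t => mass u 0 t ^ p * u t * supWeight w v (a * (p + 1)) p t +
    mass (fun x => u x * mass w x t ^ a) 0 t ^ p * u t * supWeight w v a p t
  have hblock : ∀ i ∈ S, (∑ j ∈ S with j ≤ i, d j) ^ p * d i * tailSup v i ^ p ≤
      2 ^ (p + 1) * (2 ^ (a * p + p) * ∫⁻ t in A i, Φ t) := by
    intro i hi
    have hg : Measurable fun x => u x * mass w x i ^ a :=
      hu.1.mul ((measurable_mass_left w i).pow_const a)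
    have h1 : ∑ j ∈ S with j ≤ i, d j = ∑ j ∈ S with j < i, d j + ∫⁻ x in A i, u x * mass w x i ^ a := by
      rw [← hd i, add_comm, ← Finset.sum_insert (by simp)]
      congr 1
      ext k
      simp only [Finset.mem_filter, Finset.mem_insert, le_iff_eq_or_lt]
      constructor
      · rintro ⟨hk, rfl | h⟩
        · exact Or.inl rfl
        · exact Or.inr ⟨hk, h⟩
      · rintro (rfl | ⟨hk, h⟩)
        · exact ⟨hi, Or.inl rfl⟩
        · exact ⟨hk, Or.inr h⟩
    have h2 := rpow_mul_lintegral_le (Z := fun t => mass (fun x => u x * mass w x i ^ a) 0 t)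
      (D := ∑ j ∈ S with j < i, d j) hg (hA i) (hAsub i) (hd i ▸ hdt i) hp.le fun t ht => by
        simp_rw [hd]
        exact sum_add_mass_le ha hP hi ht
    rw [h1, hd i]
    refine (mul_le_mul_left h2 _).trans ?_
    rw [mul_assoc]
    refine mul_le_mul_right ?_ _
    have hmY : Measurable fun t => mass (fun x => u x * mass w x i ^ a) 0 t ^ p *
        (u t * mass w t i ^ a) := ((measurable_mass_right _ 0).pow_const p).mul hg
    rw [← lintegral_mul_const _ hmY, ← lintegral_const_mul' _ _ (by simp)]
    refine setLIntegral_mono' (hA i) fun t _ => ?_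
    have h3 : mass w t i ^ (a * (p + 1)) * tailSup v i ^ p ≤ supWeight w v (a * (p + 1)) p t :=
      le_iSup (fun s : ℚ => mass w t s ^ (a * (p + 1)) * tailSup v s ^ p) i
    have h4 : mass w t i ^ a * tailSup v i ^ p ≤ supWeight w v a p t :=
      le_iSup (fun s : ℚ => mass w t s ^ a * tailSup v s ^ p) i
    have h5 : mass w t i ^ (a * (p + 1)) = mass w t i ^ (a * p) * mass w t i ^ a := by
      rw [← ENNReal.rpow_add_of_nonneg _ _ (mul_nonneg ha.le hp.le) ha.le]
      congr 1
      ring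
    calc _ ≤ 2 ^ (a * p + p) * (mass (fun x => u x * mass w x t ^ a) 0 t ^ p +
        mass u 0 t ^ p * mass w t i ^ (a * p)) * (u t * mass w t i ^ a) * tailSup v i ^ p := by
          gcongr
          exact mass_mul_rpow_le hu.1 ha hp i t
      _ = 2 ^ (a * p + p) * (mass u 0 t ^ p * u t *
          (mass w t i ^ (a * (p + 1)) * tailSup v i ^ p) +
          mass (fun x => u x * mass w x t ^ a) 0 t ^ p * u t *
            (mass w t i ^ a * tailSup v i ^ p)) := by
          rw [h5]
          ring
      _ ≤ _ := by
          dsimp only [Φ]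
          gcongr
  refine (Finset.sum_le_sum hblock).trans ?_
  rw [← Finset.mul_sum, ← Finset.mul_sum]
  refine mul_le_mul_right (mul_le_mul_right ?_ _) _
  rw [← lintegral_biUnion_finset (pairwiseDisjoint_firstMax _ S) fun i _ => hA i]
  refine (lintegral_mono_set (t := Ioi 0) (by simpa only [iUnion_subset_iff] using fun i _ => hAsub i)).trans
    (le_of_eq ?_)
  exact lintegral_add_left ((((measurable_mass_right u 0).pow_const p).mul hu.1).mul
    (supWeight_anti w v (mul_nonneg ha.le (by linarith)) p).measurable) _

theorem lintegral_iSup_finset_le {q r : ℝ} (hq : 0 < q) (hr0 : 0 < r) (hr1 : r < 1)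
    {u v w h : ℝ → ℝ≥0∞} (hu : IsWeight u) (hv : IsWeight v) (hw : IsWeight w)
    (hh : Measurable h) (S : Finset ℚ) (hS : ∀ i ∈ S, 0 < i) (hV : ∀ i ∈ S, tailSup v i ≠ ∞)
    {a p : ℝ} (ha : a = r / q) (hp : p = r / (1 - r)) :
    ∫⁻ t in Ioi 0, u t * ⨆ i ∈ S, mass w t i ^ a * tail h i ^ r ≤
      (ENNReal.ofReal (p + 2) * (2 ^ (p + 1) * (2 ^ (a * p + p) *
        ((∫⁻ t in Ioi 0, mass u 0 t ^ p * u t * supWeight w v (a * (p + 1)) p t) +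
        ∫⁻ t in Ioi 0, mass (fun x => u x * mass w x t ^ a) 0 t ^ p * u t *
          supWeight w v a p t)))) ^ (1 - r) * (∫⁻ y in Ioi 0, h y * v y) ^ r := by
  have h1r : 0 < 1 - r := by linarith
  have ha0 : 0 < a := ha ▸ div_pos hr0 hq
  have hp0 : 0 < p := hp ▸ div_pos hr0 h1r
  set P : ℚ → ℝ≥0∞ := fun i => tail h i ^ q
  have hP : Antitone P := fun i j hij => ENNReal.rpow_le_rpow
    (lintegral_mono_set (Ioi_subset_Ioi (by exact_mod_cast hij))) hq.le
  have hf : ∀ (i : ℚ) (t : ℝ), (mass w t i * P i) ^ a = mass w t i ^ a * tail h i ^ r := by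
    intro i t
    rw [ENNReal.mul_rpow_of_nonneg _ _ ha0.le, ← ENNReal.rpow_mul, ha, mul_div_cancel₀ _ hq.ne']
  set d : ℚ → ℝ≥0∞ := fun i => ∫⁻ x in firstMax (fun i t => mass w t i * P i) S i,
    u x * mass w x i ^ a with hd
  have hdt : ∀ i, d i ≠ ∞ := by
    intro i
    refine ne_top_of_le_ne_top (b := mass u 0 i * mass w 0 i ^ a) (ENNReal.mul_ne_top
      (mass_lt_top hu le_rfl _).ne (ENNReal.rpow_ne_top_of_nonneg ha0.le
      (mass_lt_top hw le_rfl _).ne)) ?_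
    refine (lintegral_mono_set (firstMax_subset i)).trans ?_
    unfold mass
    rw [← lintegral_mul_const _ hu.1]
    refine setLIntegral_mono' measurableSet_Ioc fun x hx => ?_
    refine mul_le_mul_right (ENNReal.rpow_le_rpow ?_ ha0.le) _
    exact mass_mono hx.1.le le_rfl
  have h1 := setLIntegral_mul_iSup_le (f := fun i t => mass w t i * P i) S hu.1
    (fun i => (measurable_mass_left w i).mul_const _) ha0
  simp_rw [hf] at h1
  have h2 : ∀ i : ℚ, ∫⁻ t in firstMax (fun i t => mass w t i * P i) S i,
      u t * (mass w t i ^ a * tail h i ^ r) = d i * tail h i ^ r := by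
    intro i
    have hg : Measurable fun x => u x * mass w x i ^ a :=
      hu.1.mul ((measurable_mass_left w i).pow_const a)
    simp_rw [← mul_assoc]
    rw [lintegral_mul_const _ hg]
  simp_rw [h2] at h1
  refine h1.trans ((sum_mul_tail_rpow_le hr0 hr1 hv hh S hS hV fun i _ => hdt i).trans ?_)
  rw [← hp]
  refine mul_le_mul_left (ENNReal.rpow_le_rpow (mul_le_mul_right ?_ _) h1r.le) _
  exact sum_block_mul_tailSup_le hu ha0 hp0 hP S (fun i => rfl) hdt

theorem mul_iSup_mass_le {q r : ℝ} (hq : 0 < q) (hr0 : 0 < r) {v w h : ℝ → ℝ≥0∞} {b p : ℝ}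
    (hb : 0 < b) (hp : 0 < p) {t : ℝ} (ht : 0 < t) (hΦ : supWeight w v b p t ≠ ∞) :
    ⨆ s ∈ Ioi t, (∫⁻ y in Ioc t s, w y) ^ (r / q) * (∫⁻ y in Ioi s, h y) ^ r ≤
      ⨆ S : Finset {s : ℚ // 0 < s ∧ tailSup v s ≠ ∞},
        ⨆ i ∈ S.map (Function.Embedding.subtype _), mass w t i ^ (r / q) * tail h i ^ r := by
  have ha : 0 < r / q := div_pos hr0 hq
  refine (iSup_mass_mul_tail_le w h ha.le hr0 t).trans (iSup_le fun s => ?_)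
  by_cases hs : 0 < s ∧ tailSup v s ≠ ∞
  · refine le_iSup_of_le {⟨s, hs⟩} ?_
    simp
  · have : mass w t s = 0 := by
      by_cases h0 : 0 < s
      · have hV : tailSup v s = ∞ := by
          by_contra hV
          exact hs ⟨h0, hV⟩
        by_contra hm
        refine hΦ (top_le_iff.1 (le_trans (le_of_eq ?_)
          (le_iSup (fun s : ℚ => mass w t s ^ b * tailSup v s ^ p) s)))
        simp only [hV, ENNReal.top_rpow_of_pos hp]
        rw [ENNReal.mul_top]
        simp [hm, hb, hb.not_gt]
      · exact mass_of_le (le_trans (by exact_mod_cast not_lt.1 h0) ht.le)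
    rw [this, ENNReal.zero_rpow_of_pos ha, zero_mul]
    exact zero_le

theorem lintegral_mul_iSup_le {q r : ℝ} (hq : 0 < q) (hr0 : 0 < r) (hr1 : r < 1)
    {u v w h : ℝ → ℝ≥0∞} (hu : IsWeight u) (hv : IsWeight v) (hw : IsWeight w)
    (hh : Measurable h) {a p : ℝ} (ha : a = r / q) (hp : p = r / (1 - r))
    (hfin : ∫⁻ t in Ioi 0, mass u 0 t ^ p * u t * supWeight w v (a * (p + 1)) p t ≠ ∞) :
    ∫⁻ t in Ioi 0, u t * ⨆ s ∈ Ioi t,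
        (∫⁻ y in Ioc t s, w y) ^ (r / q) * (∫⁻ y in Ioi s, h y) ^ r ≤
      (ENNReal.ofReal (p + 2) * (2 ^ (p + 1) * (2 ^ (a * p + p) *
        ((∫⁻ t in Ioi 0, mass u 0 t ^ p * u t * supWeight w v (a * (p + 1)) p t) +
        ∫⁻ t in Ioi 0, mass (fun x => u x * mass w x t ^ a) 0 t ^ p * u t *
          supWeight w v a p t)))) ^ (1 - r) * (∫⁻ y in Ioi 0, h y * v y) ^ r := by
  have h1r : 0 < 1 - r := by linarith
  have ha0 : 0 < a := ha ▸ div_pos hr0 hq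
  have hp0 : 0 < p := hp ▸ div_pos hr0 h1r
  have hb0 : 0 < a * (p + 1) := mul_pos ha0 (by linarith)
  have hmeas : Measurable fun t => mass u 0 t ^ p * u t * supWeight w v (a * (p + 1)) p t :=
    (((measurable_mass_right u 0).pow_const p).mul hu.1).mul (supWeight_anti w v hb0.le p).measurable
  calc _ ≤ ∫⁻ t in Ioi 0, ⨆ S : Finset {s : ℚ // 0 < s ∧ tailSup v s ≠ ∞}, u t *
        ⨆ i ∈ S.map (Function.Embedding.subtype _), mass w t i ^ a * tail h i ^ r := by
        refine lintegral_mono_ae ?_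
        filter_upwards [ae_lt_top hmeas hfin, ae_restrict_mem measurableSet_Ioi] with t h1 ht
        rw [← ENNReal.mul_iSup, ha]
        by_cases hut : u t = 0
        · simp [hut]
        refine mul_le_mul_right (mul_iSup_mass_le hq hr0 hb0 hp0 ht fun h2 => ?_) _
        rw [h2, ENNReal.mul_top] at h1
        · exact lt_irrefl _ h1
        · have h3 : mass u 0 t ≠ 0 := (hu.2 t ht).1.ne'
          simp [hut, h3, hp0, hp0.not_gt]
    _ = ⨆ S : Finset {s : ℚ // 0 < s ∧ tailSup v s ≠ ∞}, ∫⁻ t in Ioi 0, u t *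
        ⨆ i ∈ S.map (Function.Embedding.subtype _), mass w t i ^ a * tail h i ^ r := by
        refine lintegral_iSup_directed (fun S => ?_) ?_
        · have hm : Measurable fun t =>
              ⨆ i ∈ S.map (Function.Embedding.subtype _), mass w t i ^ a * tail h i ^ r :=
            Measurable.biSup (S.map (Function.Embedding.subtype _) : Set ℚ)
              (Finset.countable_toSet _) fun i _ =>
                ((measurable_mass_left w i).pow_const a).mul_const _
          exact (hu.1.mul hm).aemeasurable
        · refine Monotone.directed_le fun S T hST t => ?_
          refine mul_le_mul_right (iSup_le_iSup_of_subset ?_) _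
          exact Finset.map_subset_map.2 hST
    _ ≤ _ := by
        refine iSup_le fun S => lintegral_iSup_finset_le hq hr0 hr1 hu hv hw hh _ ?_ ?_ ha hp
        · intro i hi
          obtain ⟨j, _, rfl⟩ := Finset.mem_map.1 hi
          exact j.2.1
        · intro i hi
          obtain ⟨j, _, rfl⟩ := Finset.mem_map.1 hi
          exact j.2.2

theorem exists_const_le {q r : ℝ} (hq : 0 < q) (hr0 : 0 < r) (hr1 : r < 1) {a p : ℝ}
    (ha : a = r / q) (hp : p = r / (1 - r)) :
    ∃ K : ℝ≥0∞, K ≠ ∞ ∧ ∀ u v w : ℝ → ℝ≥0∞, IsWeight u → IsWeight v → IsWeight w →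
      ∀ C : ℝ≥0∞, (∀ h : ℝ → ℝ≥0∞, Measurable h →
        supLHS q r u w h ≤ C * ∫⁻ s in Ioi (0 : ℝ), h s * v s) →
      (∫⁻ t in Ioi 0, mass u 0 t ^ p * u t * supWeight w v (a * (p + 1)) p t) ^ ((1 - r) / r) +
        (∫⁻ t in Ioi 0, mass (fun x => u x * mass w x t ^ a) 0 t ^ p * u t *
          supWeight w v a p t) ^ ((1 - r) / r) ≤ K * C := by
  have h1r : 0 < 1 - r := by linarith
  have ha0 : 0 < a := ha ▸ div_pos hr0 hq
  have hp0 : 0 < p := hp ▸ div_pos hr0 h1r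
  have he0 : 0 < (1 - r) / r := div_pos h1r hr0
  set lam : ℝ≥0∞ := 2 * 2 ^ a with hlam
  have hlam2 : 2 ≤ lam := le_mul_of_one_le_right' (ENNReal.one_le_rpow one_le_two ha0)
  have hlamt : lam ≠ ∞ := ENNReal.mul_ne_top ENNReal.ofNat_ne_top
    (ENNReal.rpow_ne_top_of_nonneg ha0.le ENNReal.ofNat_ne_top)
  have hρ : (ENNReal.ofReal r)⁻¹ ≠ ∞ := by simpa using hr0
  set R : ℝ≥0∞ := (ENNReal.ofReal r)⁻¹ ^ p
  have hR : R ≠ ∞ := ENNReal.rpow_ne_top_of_nonneg hp0.le hρ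
  have hpow : ∀ C k : ℝ≥0∞, (k * (C / ENNReal.ofReal r) ^ r) ^ (1 / (1 - r)) =
      k ^ (1 / (1 - r)) * R * C ^ p := by
    intro C k
    rw [ENNReal.mul_rpow_of_nonneg _ _ (by positivity), ← ENNReal.rpow_mul, mul_one_div, ← hp,
      div_eq_mul_inv (C : ℝ≥0∞), ENNReal.mul_rpow_of_nonneg _ _ hp0.le]
    ring
  have hpe : ∀ C : ℝ≥0∞, (C ^ p) ^ ((1 - r) / r) = C := by
    intro C
    rw [← ENNReal.rpow_mul, hp, div_mul_div_cancel₀ h1r.ne', div_self hr0.ne', ENNReal.rpow_one]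
  set K₁ : ℝ≥0∞ := lam ^ (p + 1) * (2 ^ (p + 1) * (1 ^ (1 / (1 - r)) * R))
  set K₂ : ℝ≥0∞ := 2 ^ p * lam ^ p * lam * (2 * (2 ^ (1 / (1 - r)) * R)) +
    2 ^ p * 2 ^ p * (lam * lam) ^ (p + 1) * (2 ^ (p + 1) * (1 ^ (1 / (1 - r)) * R))
  have hfin : ∀ {x : ℝ≥0∞} {b : ℝ}, x ≠ ∞ → 0 ≤ b → x ^ b ≠ ∞ := fun hx hb =>
    ENNReal.rpow_ne_top_of_nonneg hb hx
  have h2 : (2 : ℝ≥0∞) ≠ ∞ := ENNReal.ofNat_ne_top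
  have hp1 : 0 ≤ p + 1 := by linarith
  have hs : 0 ≤ 1 / (1 - r) := by positivity
  have hK₁ : K₁ ≠ ∞ := ENNReal.mul_ne_top (hfin hlamt hp1) (ENNReal.mul_ne_top (hfin h2 hp1)
    (ENNReal.mul_ne_top (hfin ENNReal.one_ne_top hs) hR))
  have hK₂ : K₂ ≠ ∞ := ENNReal.add_ne_top.2
    ⟨ENNReal.mul_ne_top (ENNReal.mul_ne_top (ENNReal.mul_ne_top (hfin h2 hp0.le)
      (hfin hlamt hp0.le)) hlamt) (ENNReal.mul_ne_top h2 (ENNReal.mul_ne_top (hfin h2 hs) hR)),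
    ENNReal.mul_ne_top (ENNReal.mul_ne_top (ENNReal.mul_ne_top (hfin h2 hp0.le) (hfin h2 hp0.le))
      (hfin (ENNReal.mul_ne_top hlamt hlamt) hp1)) (ENNReal.mul_ne_top (hfin h2 hp1)
      (ENNReal.mul_ne_top (hfin ENNReal.one_ne_top hs) hR))⟩
  refine ⟨K₁ ^ ((1 - r) / r) + K₂ ^ ((1 - r) / r),
    ENNReal.add_ne_top.2 ⟨hfin hK₁ he0.le, hfin hK₂ he0.le⟩, fun u v w hu hv hw C hC => ?_⟩
  have hC' : ∀ h : ℝ → ℝ≥0∞, Measurable h →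
      ∫⁻ t in Ioi (0 : ℝ), u t * ⨆ s ∈ Ioi t, mass w t s ^ a * tail h s ^ r ≤
        (C * ∫⁻ s in Ioi (0 : ℝ), h s * v s) ^ r := by
    intro h hh
    have h3 := ENNReal.rpow_le_rpow (hC h hh) hr0.le
    rw [supLHS, ← ENNReal.rpow_mul, one_div_mul_cancel hr0.ne', ENNReal.rpow_one, ← ha] at h3
    exact h3
  obtain ⟨N, τ, hD⟩ := exists_isDyadic hu (ENNReal.one_lt_two.trans_le hlam2) hlamt
  have h4 := lintegral_mass_supWeight_le hr0 hr1 ha0 hu hv hw hC' hlam2 hlamt hD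
  have h5 := lintegral_absorb_supWeight_le hr0 hr1 ha0 hu hv hw hC' hlam hD
  simp only [hpow, ← hp] at h4 h5
  rw [add_mul]
  have h6 := ENNReal.rpow_le_rpow (h4.trans_eq (b := _) (c := K₁ * C ^ p)
    (by simp only [K₁]; ring)) he0.le
  have h7 := ENNReal.rpow_le_rpow (h5.trans_eq (b := _) (c := K₂ * C ^ p)
    (by simp only [K₂]; ring)) he0.le
  rw [ENNReal.mul_rpow_of_nonneg _ _ he0.le, hpe] at h6 h7
  exact add_le_add h6 h7

theorem exists_const_supLHS_le {q r : ℝ} (hq : 0 < q) (hr0 : 0 < r) (hr1 : r < 1) {a p : ℝ}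
    (ha : a = r / q) (hp : p = r / (1 - r)) :
    ∃ K : ℝ≥0∞, K ≠ ∞ ∧ ∀ u v w : ℝ → ℝ≥0∞, IsWeight u → IsWeight v → IsWeight w →
      (∫⁻ t in Ioi 0, mass u 0 t ^ p * u t * supWeight w v (a * (p + 1)) p t) ^ ((1 - r) / r) ≠ ∞ →
      ∀ h : ℝ → ℝ≥0∞, Measurable h → supLHS q r u w h ≤ K *
        ((∫⁻ t in Ioi 0, mass u 0 t ^ p * u t * supWeight w v (a * (p + 1)) p t) ^ ((1 - r) / r) +
        (∫⁻ t in Ioi 0, mass (fun x => u x * mass w x t ^ a) 0 t ^ p * u t *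
          supWeight w v a p t) ^ ((1 - r) / r)) * ∫⁻ s in Ioi (0 : ℝ), h s * v s := by
  have h1r : 0 < 1 - r := by linarith
  have ha0 : 0 < a := ha ▸ div_pos hr0 hq
  have hp0 : 0 < p := hp ▸ div_pos hr0 h1r
  have he0 : 0 < (1 - r) / r := div_pos h1r hr0
  have h2 : ∀ {b : ℝ}, 0 ≤ b → (2 : ℝ≥0∞) ^ b ≠ ∞ := fun hb =>
    ENNReal.rpow_ne_top_of_nonneg hb ENNReal.ofNat_ne_top
  set K₀ : ℝ≥0∞ := ENNReal.ofReal (p + 2) * (2 ^ (p + 1) * 2 ^ (a * p + p))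
  have hK₀ : K₀ ≠ ∞ := ENNReal.mul_ne_top ENNReal.ofReal_ne_top
    (ENNReal.mul_ne_top (h2 (by linarith)) (h2 (by positivity)))
  refine ⟨K₀ ^ ((1 - r) / r) * 2 ^ ((1 - r) / r), ENNReal.mul_ne_top
    (ENNReal.rpow_ne_top_of_nonneg he0.le hK₀) (h2 he0.le), fun u v w hu hv hw hfin h hh => ?_⟩
  have hfin' : ∫⁻ t in Ioi 0, mass u 0 t ^ p * u t * supWeight w v (a * (p + 1)) p t ≠ ∞ := by
    intro h3
    rw [h3, ENNReal.top_rpow_of_pos he0] at hfin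
    exact hfin rfl
  have h4 := ENNReal.rpow_le_rpow (lintegral_mul_iSup_le hq hr0 hr1 hu hv hw hh ha hp hfin')
    (one_div_nonneg.2 hr0.le)
  refine h4.trans ?_
  rw [ENNReal.mul_rpow_of_nonneg _ _ (one_div_nonneg.2 hr0.le), ← ENNReal.rpow_mul,
    ← ENNReal.rpow_mul, mul_one_div_cancel hr0.ne', ENNReal.rpow_one, mul_one_div]
  refine mul_le_mul_left ?_ _
  rw [← mul_assoc (2 ^ (p + 1)), ← mul_assoc (ENNReal.ofReal _),
    ENNReal.mul_rpow_of_nonneg _ _ he0.le, mul_assoc]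
  exact mul_le_mul_right (add_rpow_le_two _ _ he0.le) _

end SupremalHardy

/-- case `0 < r < 1`: the inequality
`supLHS(h) ≤ C ∫_0^∞ h v` holds for all `h ≥ 0` with some finite `C` iff
`E₁ < ∞` and `E₂ < ∞`; moreover the best constant satisfies `C ≈ E₁ + E₂`. -/
theorem sup_inequality_characterization_r_lt_one
    (q r : ℝ) (hq : 0 < q) (hr0 : 0 < r) (hr1 : r < 1) :
    ∃ c₁ c₂ : ℝ≥0∞, 0 < c₁ ∧ c₂ < ∞ ∧
      ∀ u v w : ℝ → ℝ≥0∞, IsWeight u → IsWeight v → IsWeight w →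
        (((∃ C : ℝ≥0∞, C < ∞ ∧ ∀ h : ℝ → ℝ≥0∞, Measurable h →
              supLHS q r u w h ≤ C * ∫⁻ s in Set.Ioi (0 : ℝ), h s * v s) ↔
          ((∫⁻ t in Set.Ioi (0 : ℝ),
              (∫⁻ s in Set.Ioc 0 t, u s) ^ (r / (1 - r)) * u t *
                essSup (fun s => (∫⁻ y in Set.Ioc t s, w y) ^ ((r / (1 - r)) / q) *
                  (v s) ^ (-(r / (1 - r)))) (volume.restrict (Set.Ici t))
              ) ^ ((1 - r) / r) < ∞ ∧
           (∫⁻ t in Set.Ioi (0 : ℝ),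
              (∫⁻ s in Set.Ioc 0 t,
                  u s * (∫⁻ y in Set.Ioc s t, w y) ^ (r / q)) ^ (r / (1 - r)) * u t *
                essSup (fun s => (∫⁻ y in Set.Ioc t s, w y) ^ (r / q) *
                  (v s) ^ (-(r / (1 - r)))) (volume.restrict (Set.Ici t))
              ) ^ ((1 - r) / r) < ∞)) ∧
        (c₁ * ((∫⁻ t in Set.Ioi (0 : ℝ),
              (∫⁻ s in Set.Ioc 0 t, u s) ^ (r / (1 - r)) * u t *
                essSup (fun s => (∫⁻ y in Set.Ioc t s, w y) ^ ((r / (1 - r)) / q) *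
                  (v s) ^ (-(r / (1 - r)))) (volume.restrict (Set.Ici t))
              ) ^ ((1 - r) / r)
            + (∫⁻ t in Set.Ioi (0 : ℝ),
              (∫⁻ s in Set.Ioc 0 t,
                  u s * (∫⁻ y in Set.Ioc s t, w y) ^ (r / q)) ^ (r / (1 - r)) * u t *
                essSup (fun s => (∫⁻ y in Set.Ioc t s, w y) ^ (r / q) *
                  (v s) ^ (-(r / (1 - r)))) (volume.restrict (Set.Ici t))
              ) ^ ((1 - r) / r))
          ≤ sInf {C : ℝ≥0∞ | ∀ h : ℝ → ℝ≥0∞, Measurable h →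
              supLHS q r u w h ≤ C * ∫⁻ s in Set.Ioi (0 : ℝ), h s * v s} ∧
         sInf {C : ℝ≥0∞ | ∀ h : ℝ → ℝ≥0∞, Measurable h →
              supLHS q r u w h ≤ C * ∫⁻ s in Set.Ioi (0 : ℝ), h s * v s}
          ≤ c₂ * ((∫⁻ t in Set.Ioi (0 : ℝ),
              (∫⁻ s in Set.Ioc 0 t, u s) ^ (r / (1 - r)) * u t *
                essSup (fun s => (∫⁻ y in Set.Ioc t s, w y) ^ ((r / (1 - r)) / q) *
                  (v s) ^ (-(r / (1 - r)))) (volume.restrict (Set.Ici t))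
              ) ^ ((1 - r) / r)
            + (∫⁻ t in Set.Ioi (0 : ℝ),
              (∫⁻ s in Set.Ioc 0 t,
                  u s * (∫⁻ y in Set.Ioc s t, w y) ^ (r / q)) ^ (r / (1 - r)) * u t *
                essSup (fun s => (∫⁻ y in Set.Ioc t s, w y) ^ (r / q) *
                  (v s) ^ (-(r / (1 - r)))) (volume.restrict (Set.Ici t))
              ) ^ ((1 - r) / r)))) := by
  have h1r : 0 < 1 - r := by linarith
  have hp0 : 0 < r / (1 - r) := div_pos hr0 h1r
  have ha0 : 0 < r / q := div_pos hr0 hq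
  have hb : r / (1 - r) / q = r / q * (r / (1 - r) + 1) := by
    field_simp
    ring
  have hb0 : 0 < r / q * (r / (1 - r) + 1) := mul_pos ha0 (by linarith)
  obtain ⟨K, hK, hnec⟩ := SupremalHardy.exists_const_le hq hr0 hr1 rfl rfl
  obtain ⟨L, hL, hsuff⟩ := SupremalHardy.exists_const_supLHS_le hq hr0 hr1 rfl rfl
  have hK1 : K + 1 ≠ ∞ := ENNReal.add_ne_top.2 ⟨hK, ENNReal.one_ne_top⟩
  have hL1 : L + 1 ≠ ∞ := ENNReal.add_ne_top.2 ⟨hL, ENNReal.one_ne_top⟩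
  refine ⟨(K + 1)⁻¹, L + 1, ENNReal.inv_pos.2 hK1, hL1.lt_top, fun u v w hu hv hw => ?_⟩
  simp only [hb, SupremalHardy.essSup_eq_supWeight w v hb0 hp0,
    SupremalHardy.essSup_eq_supWeight w v ha0 hp0]
  replace hnec := hnec u v w hu hv hw
  replace hsuff := hsuff u v w hu hv hw
  simp only [SupremalHardy.mass] at hnec hsuff
  generalize (∫⁻ t in Set.Ioi (0 : ℝ), (∫⁻ s in Set.Ioc 0 t, u s) ^ (r / (1 - r)) * u t *
    SupremalHardy.supWeight w v (r / q * (r / (1 - r) + 1)) (r / (1 - r)) t) ^ ((1 - r) / r) = E₁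
    at hnec hsuff ⊢
  generalize (∫⁻ t in Set.Ioi (0 : ℝ), (∫⁻ s in Set.Ioc 0 t,
    u s * (∫⁻ y in Set.Ioc s t, w y) ^ (r / q)) ^ (r / (1 - r)) * u t *
    SupremalHardy.supWeight w v (r / q) (r / (1 - r)) t) ^ ((1 - r) / r) = E₂ at hnec hsuff ⊢
  have hsuff' : E₁ < ∞ → ∀ h : ℝ → ℝ≥0∞, Measurable h →
      supLHS q r u w h ≤ (L + 1) * (E₁ + E₂) * ∫⁻ s in Set.Ioi (0 : ℝ), h s * v s :=
    fun h₁ h hh => (hsuff h₁.ne h hh).trans (by gcongr; exact le_self_add)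
  refine ⟨⟨fun ⟨C, hC, hineq⟩ => ENNReal.add_lt_top.1 ((hnec C hineq).trans_lt
    (ENNReal.mul_lt_top hK.lt_top hC)), fun ⟨h₁, h₂⟩ => ⟨(L + 1) * (E₁ + E₂), ?_, hsuff' h₁⟩⟩,
    le_sInf fun C hC => ?_, ?_⟩
  · exact ENNReal.mul_lt_top hL1.lt_top (ENNReal.add_lt_top.2 ⟨h₁, h₂⟩)
  · refine (ENNReal.inv_mul_le_iff (by simp) hK1).2 ((hnec C hC).trans ?_)
    gcongr
    exact le_self_add
  · by_cases h₁ : E₁ = ∞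
    · simp [h₁]
    · exact sInf_le (hsuff' (lt_top_iff_ne_top.2 h₁))
end
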